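/- arXiv:1106.1054 — 5 statements merged into one kernel-verified Lean document; each statement's English description precedes it below -/
import Mathlib

section
/- Let D be a positive odd integer and let s be a complex number with Re(s) > 1/2. Then the series ∑_{ν=0}^∞ (−1)^ν · (D²/4)^ν · C(−s,ν) · [ζ(2s+2ν) − ∑_{a=1}^{⌊D/2⌋} a^{−2s−2ν}] converges absolutely, and ∑_{a=⌊D/2⌋+1}^∞ (4a² − D²)^{−s} = 4^{−s} · ∑_{ν=0}^∞ (−1)^ν · (D²/4)^ν · C(−s,ν) · [ζ(2s+2ν) − ∑_{a=1}^{⌊D/2⌋} a^{−2s−2ν}], where C(−s,ν) = (−s)(−s−1)⋯(−s−ν+1)/ν! is the generalized binomial coefficient. -/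
/-- Generalized binomial coefficient `C(s, ν) = s (s−1) ⋯ (s−ν+1) / ν!`. -/
noncomputable def genBinom (s : ℂ) (ν : ℕ) : ℂ :=
  (∏ i ∈ Finset.range ν, (s - (i : ℂ))) / (Nat.factorial ν : ℂ)

lemma genBinom_eq (s : ℂ) (ν : ℕ) : genBinom s ν = Ring.choose s ν := by
  rw [genBinom, Ring.choose_eq_smul, ← Polynomial.aeval_eq_smeval, Polynomial.aeval_def,
    Polynomial.eval₂_eq_eval_map, descPochhammer_map,
    descPochhammer_eval_eq_prod_range, div_eq_inv_mul, smul_eq_mul]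

lemma binom_hasSum (s x : ℂ) (hx : ‖x‖ < 1) :
    HasSum (fun ν => genBinom s ν * x ^ ν) ((1 + x) ^ s) := by
  have h := (Complex.one_add_cpow_hasFPowerSeriesOnBall_zero (a := s)).hasSum (y := x)
    (by rw [← ENNReal.ofReal_one, Metric.eball_ofReal]; simpa using hx)
  rw [zero_add] at h
  have e : (fun ν => genBinom s ν * x ^ ν) = fun n => (binomialSeries ℂ s n) fun _ => x := by
    funext ν
    rw [binomialSeries_apply, genBinom_eq]
    simp
  rw [e]
  exact h

lemma binom_summable (s : ℂ) (r : ℝ) (h0 : 0 ≤ r) (h1 : r < 1) :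
    Summable (fun ν => ‖genBinom s ν‖ * r ^ ν) := by
  have h := (binom_hasSum s r (by simpa [abs_of_nonneg h0] using h1)).summable.norm
  simpa [abs_of_nonneg h0] using h

lemma zeta_tail (m : ℕ) (w : ℂ) (hw : 1 < w.re) :
    riemannZeta w - ∑ a ∈ Finset.Icc 1 m, (a : ℂ) ^ (-w) =
      ∑' a : ℕ, ((a + m + 1 : ℕ) : ℂ) ^ (-w) := by
  have hsum : Summable (fun n : ℕ => (n : ℂ) ^ (-w)) := by
    simpa [Complex.cpow_neg] using Complex.summable_one_div_nat_cpow.2 hw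
  have hz : riemannZeta w = ∑' n : ℕ, (n : ℂ) ^ (-w) := by
    simpa [Complex.cpow_neg] using zeta_eq_tsum_one_div_nat_cpow hw
  have hw0 : -w ≠ 0 := neg_ne_zero.2 (Complex.ne_zero_of_one_lt_re hw)
  rw [hz, ← hsum.sum_add_tsum_nat_add (m + 1), Finset.sum_range_succ', sub_eq_iff_eq_add]
  have e : ∑ a ∈ Finset.Icc 1 m, (a : ℂ) ^ (-w) =
      ∑ k ∈ Finset.range m, ((k + 1 : ℕ) : ℂ) ^ (-w) := by
    rw [← Finset.Ico_add_one_right_eq_Icc, Finset.sum_Ico_eq_sum_range, Nat.add_sub_cancel]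
    exact Finset.sum_congr rfl fun k _ => by rw [add_comm]
  rw [e, Nat.cast_zero, Complex.zero_cpow hw0, add_zero, add_comm]
  rfl

lemma base_eq (D b : ℕ) (hb : D < 2 * b) (s : ℂ) :
    (4 * (b : ℂ) ^ 2 - (D : ℂ) ^ 2) ^ (-s) =
      (4 : ℂ) ^ (-s) * ((b : ℂ) ^ (-(2 * s)) *
        (1 + (-((D : ℂ) ^ 2 / 4 / (b : ℂ) ^ 2))) ^ (-s)) := by
  have hb0 : (0 : ℝ) < b := by exact_mod_cast (by omega : 0 < b)
  have hbC : (b : ℂ) ≠ 0 := by exact_mod_cast hb0.ne'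
  have hlt : (D : ℝ) < 2 * b := by exact_mod_cast hb
  have h1 : (0 : ℝ) ≤ 1 - (D : ℝ) ^ 2 / 4 / (b : ℝ) ^ 2 := by
    rw [sub_nonneg, div_div, div_le_one (by positivity)]
    nlinarith [Nat.cast_nonneg (α := ℝ) D]
  have e : (4 * (b : ℂ) ^ 2 - (D : ℂ) ^ 2) =
      ((4 : ℝ) : ℂ) * (((b : ℝ) * ((b : ℝ) * (1 - (D : ℝ) ^ 2 / 4 / (b : ℝ) ^ 2)) : ℝ) : ℂ) := by
    push_cast
    field_simp
  rw [e, Complex.mul_cpow_ofReal_nonneg (by norm_num) (by positivity), Complex.ofReal_mul,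
    Complex.mul_cpow_ofReal_nonneg hb0.le (by positivity), Complex.ofReal_mul,
    Complex.mul_cpow_ofReal_nonneg hb0.le h1, show -(2 * s) = -s + -s by ring,
    Complex.cpow_add _ _ hbC]
  push_cast
  rw [← sub_eq_add_neg]
  ring

lemma term_eq (D b : ℕ) (hb : 0 < b) (s c : ℂ) (ν : ℕ) :
    (-1 : ℂ) ^ ν * ((D : ℂ) ^ 2 / 4) ^ ν * c * (b : ℂ) ^ (-(2 * s + 2 * (ν : ℂ))) =
      (b : ℂ) ^ (-(2 * s)) * (c * (-((D : ℂ) ^ 2 / 4 / (b : ℂ) ^ 2)) ^ ν) := by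
  have hbC : (b : ℂ) ≠ 0 := by exact_mod_cast hb.ne'
  have : (b : ℂ) ^ (-(2 * s + 2 * (ν : ℂ))) = (b : ℂ) ^ (-(2 * s)) * (((b : ℂ) ^ 2) ^ ν)⁻¹ := by
    rw [show -(2 * s + 2 * (ν : ℂ)) = -(2 * s) + -((2 * ν : ℕ) : ℂ) by push_cast; ring,
      Complex.cpow_add _ _ hbC, Complex.cpow_neg _ ((2 * ν : ℕ) : ℂ), Complex.cpow_natCast, pow_mul]
  rw [this, neg_pow (_ / _), div_pow _ ((b : ℂ) ^ 2)]
  ring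

theorem QD_expansion_odd (D : ℕ) (hD : 0 < D) (hodd : Odd D) (s : ℂ) (hs : 1 / 2 < s.re) :
    Summable (fun ν : ℕ => ‖(-1 : ℂ) ^ ν * ((D : ℂ) ^ 2 / 4) ^ ν * genBinom (-s) ν *
        (riemannZeta (2 * s + 2 * (ν : ℂ)) -
          ∑ a ∈ Finset.Icc 1 (D / 2), (a : ℂ) ^ (-(2 * s + 2 * (ν : ℂ))))‖) ∧
    ∑' a : ℕ, (4 * ((a + D / 2 + 1 : ℕ) : ℂ) ^ 2 - (D : ℂ) ^ 2) ^ (-s) =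
      (4 : ℂ) ^ (-s) * ∑' ν : ℕ, (-1 : ℂ) ^ ν * ((D : ℂ) ^ 2 / 4) ^ ν * genBinom (-s) ν *
        (riemannZeta (2 * s + 2 * (ν : ℂ)) -
          ∑ a ∈ Finset.Icc 1 (D / 2), (a : ℂ) ^ (-(2 * s + 2 * (ν : ℂ)))) := by
  set m := D / 2 with hm
  have hb : ∀ a : ℕ, D < 2 * (a + m + 1) := fun a => by omega
  let F : ℕ → ℕ → ℂ := fun ν a => ((a + m + 1 : ℕ) : ℂ) ^ (-(2 * s)) *
    (genBinom (-s) ν * (-((D : ℂ) ^ 2 / 4 / ((a + m + 1 : ℕ) : ℂ) ^ 2)) ^ ν)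
  have hT : ∀ ν : ℕ, (-1 : ℂ) ^ ν * ((D : ℂ) ^ 2 / 4) ^ ν * genBinom (-s) ν *
        (riemannZeta (2 * s + 2 * (ν : ℂ)) -
          ∑ a ∈ Finset.Icc 1 m, (a : ℂ) ^ (-(2 * s + 2 * (ν : ℂ)))) = ∑' a, F ν a := by
    intro ν
    have hw : 1 < (2 * s + 2 * (ν : ℂ)).re := by
      simp
      have : (0 : ℝ) ≤ ν := Nat.cast_nonneg ν
      linarith
    rw [zeta_tail m _ hw, ← tsum_mul_left]
    exact tsum_congr fun a => term_eq D _ (by omega) s _ ν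
  let r : ℝ := (D : ℝ) ^ 2 / 4 / ((m + 1 : ℕ) : ℝ) ^ 2
  have hr0 : 0 ≤ r := by positivity
  have hr1 : r < 1 := by
    have : (D : ℝ) < 2 * ((m + 1 : ℕ) : ℝ) := by exact_mod_cast (by omega : D < 2 * (m + 1))
    simp only [r]
    rw [div_div, div_lt_one (by positivity)]
    nlinarith [Nat.cast_nonneg (α := ℝ) D]
  have hx : ∀ a : ℕ, ‖-((D : ℂ) ^ 2 / 4 / ((a + m + 1 : ℕ) : ℂ) ^ 2)‖ ≤ r := by
    intro a
    rw [norm_neg, norm_div, norm_div, norm_pow, norm_pow, Complex.norm_natCast,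
      Complex.norm_natCast]
    simp only [r, RCLike.norm_ofNat]
    gcongr
    omega
  have hsb : Summable (fun a : ℕ => ‖((a + m + 1 : ℕ) : ℂ) ^ (-(2 * s))‖) := by
    have h1 : Summable (fun n : ℕ => (n : ℂ) ^ (-(2 * s))) := by
      have : 1 < (2 * s).re := by simp; linarith
      simpa [Complex.cpow_neg] using Complex.summable_one_div_nat_cpow.2 this
    exact ((summable_nat_add_iff (m + 1)).2 h1).norm
  have hF : Summable (fun p : ℕ × ℕ => ‖F p.1 p.2‖) := by
    refine Summable.of_nonneg_of_le (fun _ => norm_nonneg _) ?_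
      ((binom_summable (-s) r hr0 hr1).mul_of_nonneg hsb (fun _ => by positivity)
        (fun _ => norm_nonneg _))
    rintro ⟨ν, a⟩
    simp only [F]
    rw [norm_mul, norm_mul, norm_pow, mul_comm]
    gcongr
    exact hx a
  simp only [hT]
  constructor
  · refine Summable.of_nonneg_of_le (fun _ => norm_nonneg _) (fun ν => ?_) hF.prod
    exact norm_tsum_le_tsum_norm (hF.prod_factor ν)
  · have hF' : Summable (Function.uncurry F) := Summable.of_norm hF
    rw [← hF'.tsum_comm, ← tsum_mul_left]
    refine tsum_congr fun a => ?_
    rw [base_eq D _ (hb a) s]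
    congr 1
    exact (((binom_hasSum (-s) _ ((hx a).trans_lt hr1)).mul_left _).tsum_eq).symm
end

section
/- Let D be a positive odd integer. Then, as the real number u tends to 1/2 from above, (u − 1/2) · ∑_{n>⌊D/2⌋} (2n)^{−2u} ∑_{d ∣ 4n²} μ(d)·(log d)² tends to log 2. In other words, the asymptotic Dirichlet series A has a simple pole at w = 1/2 with positive residue log 2. -/
/-- `∑_{d ∣ n} μ(d) (log d)²`. -/
noncomputable def mulog2 (n : ℕ) : ℝ :=
  ∑ d ∈ n.divisors, (ArithmeticFunction.moebius d : ℝ) * (Real.log d) ^ 2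


lemma sum_mu_real (k : ℕ) :
    ∑ d ∈ k.divisors, (ArithmeticFunction.moebius d : ℝ) = if k = 1 then 1 else 0 := by
  have := congrArg (fun f => f k) (ArithmeticFunction.coe_moebius_mul_coe_zeta (R := ℝ))
  simp only [ArithmeticFunction.coe_mul_zeta_apply] at this
  simpa [ArithmeticFunction.one_apply] using this

lemma mulog2_two_pow_mul (a k : ℕ) (hk : Odd k) :
    mulog2 (2 ^ (a + 1) * k) =
      2 * Real.log 2 * ArithmeticFunction.vonMangoldt k -
        (if k = 1 then Real.log 2 ^ 2 else 0) := by
  have hc : (2 ^ (a + 1)).Coprime k := Nat.Coprime.pow_left _ hk.coprime_two_left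
  have hk0 : k ≠ 0 := by rintro rfl; simp at hk
  unfold mulog2
  rw [Nat.divisors_mul, Finset.mul_def, Finset.sum_image (by simpa using hc.mul_injOn_divisors), Finset.sum_product,
    Nat.divisors_prime_pow Nat.prime_two, Finset.sum_map,
    Finset.sum_range_succ', Finset.sum_range_succ']
  have h0 : ∑ x ∈ Finset.range a, ∑ y ∈ k.divisors,
      (ArithmeticFunction.moebius (2 ^ (x + 1 + 1) * y) : ℝ) *
        Real.log ((2 ^ (x + 1 + 1) * y : ℕ) : ℝ) ^ 2 = 0 := by
    refine Finset.sum_eq_zero fun x _ => Finset.sum_eq_zero fun y _ => ?_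
    rw [ArithmeticFunction.moebius_eq_zero_of_not_squarefree]
    · simp
    · intro h
      have := h 2 ⟨2 ^ x * y, by ring⟩
      simp at this
  have h1 : ∑ y ∈ k.divisors,
      (ArithmeticFunction.moebius (2 * y) : ℝ) *
        Real.log ((2 * y : ℕ) : ℝ) ^ 2 = -(Real.log 2 ^ 2 * (∑ y ∈ k.divisors, (ArithmeticFunction.moebius y : ℝ)))
         - 2 * Real.log 2 * (∑ y ∈ k.divisors, (ArithmeticFunction.moebius y : ℝ) * ArithmeticFunction.log y)
        - ∑ y ∈ k.divisors, (ArithmeticFunction.moebius y : ℝ) * Real.log y ^ 2 := by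
    rw [Finset.mul_sum, Finset.mul_sum, ← Finset.sum_neg_distrib, ← Finset.sum_sub_distrib, ← Finset.sum_sub_distrib]
    refine Finset.sum_congr rfl fun y hy => ?_
    have hy' := Nat.dvd_of_mem_divisors hy
    have hy0 : y ≠ 0 := fun h => hk0 (by simpa [h] using hy')
    rw [ArithmeticFunction.isMultiplicative_moebius.map_mul_of_coprime
      (Nat.Coprime.coprime_dvd_right hy' hk.coprime_two_left),
      ArithmeticFunction.moebius_apply_prime Nat.prime_two, ArithmeticFunction.log_apply]
    push_cast
    rw [Real.log_mul (by norm_num) (by exact_mod_cast hy0)]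
    ring
  simp only [Function.Embedding.coeFn_mk, zero_add, pow_zero, pow_one, one_mul] at h0 h1 ⊢
  rw [h0, h1, sum_mu_real, ArithmeticFunction.sum_moebius_mul_log_eq]
  split_ifs <;> ring

noncomputable def hh (m : ℕ) : ℝ := mulog2 (4 * m ^ 2)

lemma hh_zero : hh 0 = 0 := by simp [hh, mulog2]

lemma hh_eq (a k : ℕ) (hk : Odd k) : hh (2 ^ a * k) = 2 * Real.log 2 * ArithmeticFunction.vonMangoldt k -
        (if k = 1 then Real.log 2 ^ 2 else 0) := by
  have := mulog2_two_pow_mul (2 * a + 1) (k ^ 2) hk.pow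
  rw [ArithmeticFunction.vonMangoldt_apply_pow (by norm_num)] at this
  rw [hh, show 4 * (2 ^ a * k) ^ 2 = 2 ^ (2 * a + 1 + 1) * k ^ 2 by ring, this]
  simp

lemma hh_two_mul (m : ℕ) : hh (2 * m) = hh m := by
  rcases eq_or_ne m 0 with rfl | hm
  · simp
  obtain ⟨a, k, hk, rfl⟩ := Nat.exists_eq_two_pow_mul_odd hm
  rw [hh_eq a k hk, ← mul_assoc, ← pow_succ', hh_eq _ k hk]

lemma hh_bound (m : ℕ) : |hh m| ≤ 2 * Real.log 2 * Real.log m + Real.log 2 ^ 2 := by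
  have l2 : 0 < Real.log 2 := Real.log_pos (by norm_num)
  rcases eq_or_ne m 0 with rfl | hm
  · simp [hh_zero]; positivity
  obtain ⟨a, k, hk, rfl⟩ := Nat.exists_eq_two_pow_mul_odd hm
  have hk0 : 0 < k := hk.pos
  rw [hh_eq a k hk]
  have h1 := ArithmeticFunction.vonMangoldt_le_log (n := k)
  have h2 := ArithmeticFunction.vonMangoldt_nonneg (n := k)
  have h3 : Real.log k ≤ Real.log ((2 ^ a * k : ℕ) : ℝ) := by
    apply Real.log_le_log (by exact_mod_cast hk0)
    exact_mod_cast Nat.le_mul_of_pos_left k (by positivity)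
  have h4 : 2 * Real.log 2 * ArithmeticFunction.vonMangoldt k ≤ 2 * Real.log 2 * Real.log ((2 ^ a * k : ℕ) : ℝ) := by
    gcongr; linarith
  have h5 : 0 ≤ 2 * Real.log 2 * ArithmeticFunction.vonMangoldt k := by positivity
  have h6 := sq_nonneg (Real.log 2)
  rw [abs_le]
  split_ifs <;> constructor <;> linarith

lemma hh_summable {s : ℝ} (hs : 1 < s) : Summable fun m : ℕ => hh m * (m : ℝ) ^ (-s) := by
  set e := (s - 1) / 2 with he
  have he0 : 0 < e := by rw [he]; linarith
  have l2 : 0 < Real.log 2 := Real.log_pos (by norm_num)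
  have S1 : Summable fun m : ℕ => (m : ℝ) ^ (e - s) := Real.summable_nat_rpow.2 (by linarith)
  have S2 : Summable fun m : ℕ => (m : ℝ) ^ (-s) := Real.summable_nat_rpow.2 (by linarith)
  refine Summable.of_norm_bounded
    ((S1.mul_left (2 * Real.log 2 / e)).add (S2.mul_left (Real.log 2 ^ 2))) fun m => ?_
  rcases Nat.eq_zero_or_pos m with rfl | hm
  · simp [hh_zero]; positivity
  have hm' : (0 : ℝ) < m := by exact_mod_cast hm
  have hp : 0 < (m : ℝ) ^ (-s) := by positivity
  rw [norm_mul, Real.norm_eq_abs, Real.norm_eq_abs, abs_of_pos hp, sub_eq_add_neg, Real.rpow_add hm']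
  have := Real.log_le_rpow_div hm'.le he0
  calc _ ≤ (2 * Real.log 2 * Real.log m + Real.log 2 ^ 2) * (m : ℝ) ^ (-s) := by
        gcongr; exact hh_bound m
    _ ≤ (2 * Real.log 2 * ((m : ℝ) ^ e / e) + Real.log 2 ^ 2) * (m : ℝ) ^ (-s) := by gcongr
    _ = _ := by ring

open ArithmeticFunction.vonMangoldt in
lemma resid_eq {x : ℝ} (hx : 1 < x) :
      ∑' n, residueClass (1 : ZMod 2) n / (n : ℝ) ^ x =
        (LFunctionResidueClassAux (1 : ZMod 2) x).re + 1 / (x - 1) := by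
    apply Complex.ofReal_injective
    have ha : IsUnit (1 : ZMod 2) := isUnit_one
    have h := eqOn_LFunctionResidueClassAux ha (x := (x : ℂ)) (by simpa using hx)
    simp only [Complex.ofReal_tsum, Complex.ofReal_div, Complex.ofReal_cpow (Nat.cast_nonneg _), Complex.ofReal_natCast,
      Complex.ofReal_add, Complex.ofReal_sub, Complex.ofReal_one]
    rw [← LFunctionResidueClassAux_real ha hx, h]
    simp only [Nat.totient_two, Nat.cast_one, inv_one, sub_add_cancel, LSeries, LSeries.term]
    refine tsum_congr fun n ↦ ?_
    split_ifs with hn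
    · simp [hn]
    · rfl

open ArithmeticFunction.vonMangoldt in
lemma resid_tendsto : Filter.Tendsto (fun x : ℝ => (x - 1) * ∑' n, residueClass (1 : ZMod 2) n / (n : ℝ) ^ x)
    (nhdsWithin 1 (Set.Ioi 1)) (nhds 1) := by
  have hc : ContinuousOn (fun x : ℝ ↦ (LFunctionResidueClassAux (1 : ZMod 2) x).re) (Set.Ici 1) := by
    refine Complex.continuous_re.comp_continuousOn
      ((continuousOn_LFunctionResidueClassAux (1 : ZMod 2)).comp
        Complex.continuous_ofReal.continuousOn fun x hx => by simpa using hx)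
  have h1 := (hc 1 (by simp)).tendsto.mono_left (nhdsWithin_mono _ Set.Ioi_subset_Ici_self)
  have h2 : Filter.Tendsto (fun x : ℝ => x - 1) (nhdsWithin 1 (Set.Ioi 1)) (nhds 0) := by
    have : Filter.Tendsto (fun x : ℝ => x - 1) (nhds 1) (nhds (1 - 1)) := by
      apply Continuous.tendsto; fun_prop
    simpa using this.mono_left nhdsWithin_le_nhds
  have h3 := (h2.mul h1).add_const 1
  rw [zero_mul, zero_add] at h3
  refine h3.congr' ?_
  filter_upwards [self_mem_nhdsWithin] with x hx
  have hx' : 1 < x := hx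
  have : x - 1 ≠ 0 := by linarith
  rw [resid_eq hx']
  field_simp

open ArithmeticFunction.vonMangoldt in
lemma odd_sum {s : ℝ} (hs : 1 < s) :
    ∑' j : ℕ, hh (2 * j + 1) * ((2 * j + 1 : ℕ) : ℝ) ^ (-s) =
      2 * Real.log 2 * (∑' n, residueClass (1 : ZMod 2) n / (n : ℝ) ^ s) - Real.log 2 ^ 2 := by
  have e0 (k : ℕ) : residueClass (1 : ZMod 2) (2 * k) = 0 := by
    have h2 : (2 : ZMod 2) = 0 := rfl
    simp [residueClass, h2]
  have e1 (k : ℕ) : residueClass (1 : ZMod 2) (2 * k + 1) = ArithmeticFunction.vonMangoldt (2 * k + 1) := by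
    have h2 : (2 : ZMod 2) = 0 := rfl
    simp [residueClass, h2]
  have e2 (j : ℕ) : hh (2 * j + 1) * ((2 * j + 1 : ℕ) : ℝ) ^ (-s) =
      2 * Real.log 2 * (residueClass (1 : ZMod 2) (2 * j + 1) / ((2 * j + 1 : ℕ) : ℝ) ^ s)
        - (if j = 0 then Real.log 2 ^ 2 else 0) := by
    have := hh_eq 0 (2 * j + 1) (odd_two_mul_add_one j)
    rw [pow_zero, one_mul] at this
    rw [this, e1, Real.rpow_neg (by positivity)]
    rcases eq_or_ne j 0 with rfl | hj
    · simp
    · simp [hj]; ring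
  have d1 : HasSum (fun j : ℕ => if j = 0 then Real.log 2 ^ 2 else 0) (Real.log 2 ^ 2) := hasSum_ite_eq 0 _
  have l2 : 0 < Real.log 2 := Real.log_pos (by norm_num)
  have So : Summable fun j : ℕ => hh (2 * j + 1) * ((2 * j + 1 : ℕ) : ℝ) ^ (-s) :=
    (hh_summable hs).comp_injective (i := fun j => 2 * j + 1) (fun a b h => by simpa using h)
  have Sr : Summable fun j : ℕ => (residueClass (1 : ZMod 2) (2 * j + 1) / ((2 * j + 1 : ℕ) : ℝ) ^ s) := by
    have := (So.add d1.summable).mul_left (2 * Real.log 2)⁻¹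
    refine this.congr fun j => ?_
    rw [e2]; field_simp; ring
  have key := tsum_even_add_odd (f := fun n : ℕ => residueClass (1 : ZMod 2) n / (n : ℝ) ^ s)
    (by simp only [e0]; simp) Sr
  rw [← key, tsum_congr e2, (Sr.mul_left _).tsum_sub d1.summable, d1.tsum_eq, tsum_mul_left]
  simp only [e0]
  simp

lemma full_sum {s : ℝ} (hs : 1 < s) :
    (1 - 2 ^ (-s)) * ∑' m : ℕ, hh m * (m : ℝ) ^ (-s) =
     ∑' j : ℕ, hh (2 * j + 1) * ((2 * j + 1 : ℕ) : ℝ) ^ (-s) := by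
  have S := hh_summable hs
  have So : Summable fun j : ℕ => hh (2 * j + 1) * ((2 * j + 1 : ℕ) : ℝ) ^ (-s) :=
    S.comp_injective (i := fun j => 2 * j + 1) (fun a b h => by simpa using h)
  have Se : Summable fun j : ℕ => hh (2 * j) * ((2 * j : ℕ) : ℝ) ^ (-s) :=
    S.comp_injective (i := fun j => 2 * j) (fun a b h => by simpa using h)
  have key := tsum_even_add_odd (f := fun m : ℕ => hh m * (m : ℝ) ^ (-s)) Se So
  have : ∑' j : ℕ, hh (2 * j) * ((2 * j : ℕ) : ℝ) ^ (-s) = 2 ^ (-s) * ∑' m : ℕ, hh m * (m : ℝ) ^ (-s) := by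
    rw [← tsum_mul_left]
    refine tsum_congr fun j => ?_
    rw [hh_two_mul]
    push_cast
    rw [Real.mul_rpow (by norm_num) (by positivity)]
    ring
  rw [this] at key
  linarith

open ArithmeticFunction.vonMangoldt in
theorem A_residue_odd (D : ℕ) (hD : 0 < D) (hodd : Odd D) :
    Filter.Tendsto (fun u : ℝ => (u - 1 / 2) *
        ∑' n : ℕ, mulog2 (4 * (n + D / 2 + 1) ^ 2) *
          ((2 * (n + D / 2 + 1) : ℕ) : ℝ) ^ (-2 * u))
      (nhdsWithin (1 / 2) (Set.Ioi (1 / 2))) (nhds (Real.log 2)) := by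
  set K := D / 2 + 1 with hK
  set T : ℝ → ℝ := fun s => ∑' n, residueClass (1 : ZMod 2) n / (n : ℝ) ^ s with hT
  have hs : Filter.Tendsto (fun u : ℝ => 2 * u) (nhdsWithin (1 / 2) (Set.Ioi (1 / 2)))
      (nhdsWithin 1 (Set.Ioi 1)) := by
    refine tendsto_nhdsWithin_iff.2 ⟨?_, ?_⟩
    · have : Filter.Tendsto (fun u : ℝ => 2 * u) (nhds (1 / 2)) (nhds (2 * (1 / 2))) := by
        apply Continuous.tendsto; fun_prop
      simpa using this.mono_left nhdsWithin_le_nhds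
    · filter_upwards [self_mem_nhdsWithin] with u hu
      have : (1 : ℝ) / 2 < u := hu
      simp only [Set.mem_Ioi]; linarith
  have main : Filter.Tendsto (fun s : ℝ => (2 : ℝ) ^ (-s) / (1 - 2 ^ (-s)) *
      (Real.log 2 * ((s - 1) * T s) - (s - 1) / 2 * Real.log 2 ^ 2) -
      (s - 1) / 2 * (2 : ℝ) ^ (-s) * ∑ i ∈ Finset.range K, hh i * (i : ℝ) ^ (-s))
      (nhdsWithin 1 (Set.Ioi 1)) (nhds (Real.log 2)) := by
    have c1 : Filter.Tendsto (fun s : ℝ => (2 : ℝ) ^ (-s)) (nhdsWithin 1 (Set.Ioi 1)) (nhds ((2 : ℝ) ^ (-1 : ℝ))) := by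
      have : ContinuousAt (fun s : ℝ => (2 : ℝ) ^ (-s)) 1 := by
        apply ContinuousAt.rpow continuousAt_const (by fun_prop); simp
      exact this.tendsto.mono_left nhdsWithin_le_nhds
    have c2 : Filter.Tendsto (fun s : ℝ => (s - 1) / 2) (nhdsWithin 1 (Set.Ioi 1)) (nhds 0) := by
      have : Filter.Tendsto (fun s : ℝ => (s - 1) / 2) (nhds 1) (nhds ((1 - 1) / 2)) := by
        apply Continuous.tendsto; fun_prop
      simpa using this.mono_left nhdsWithin_le_nhds
    have c3 : Filter.Tendsto (fun s : ℝ => ∑ i ∈ Finset.range K, hh i * (i : ℝ) ^ (-s))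
        (nhdsWithin 1 (Set.Ioi 1)) (nhds (∑ i ∈ Finset.range K, hh i * (i : ℝ) ^ (-1 : ℝ))) := by
      refine tendsto_finsetSum _ fun i _ => ?_
      rcases eq_or_ne i 0 with rfl | hi
      · simp [hh_zero]
      have : ContinuousAt (fun s : ℝ => hh i * (i : ℝ) ^ (-s)) 1 := by
        apply ContinuousAt.mul continuousAt_const
        apply ContinuousAt.rpow continuousAt_const (by fun_prop); simp [hi]
      exact this.tendsto.mono_left nhdsWithin_le_nhds
    have := ((c1.div (c1.const_sub 1) (by norm_num [Real.rpow_neg_one])).mul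
      ((resid_tendsto.const_mul (Real.log 2)).sub (c2.mul_const (Real.log 2 ^ 2)))).sub
      ((c2.mul c1).mul c3)
    convert! this using 2
    norm_num [Real.rpow_neg_one]
  refine (main.comp hs).congr' ?_
  filter_upwards [self_mem_nhdsWithin] with u hu
  have hu1 : (1 : ℝ) < 2 * u := by
    have : (1 : ℝ) / 2 < u := hu
    linarith
  have hne : (1 : ℝ) - 2 ^ (-(2 * u)) ≠ 0 := by
    have : (2 : ℝ) ^ (-(2 * u)) < 1 := Real.rpow_lt_one_of_one_lt_of_neg (by norm_num) (by linarith)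
    linarith
  have S := (hh_summable hu1).sum_add_tsum_nat_add K
  have F := full_sum hu1
  rw [odd_sum hu1] at F
  have E : ∑' n : ℕ, mulog2 (4 * (n + D / 2 + 1) ^ 2) *
          ((2 * (n + D / 2 + 1) : ℕ) : ℝ) ^ (-2 * u) =
      2 ^ (-(2 * u)) * ∑' i : ℕ, hh (i + K) * ((i + K : ℕ) : ℝ) ^ (-(2 * u)) := by
    rw [← tsum_mul_left]
    refine tsum_congr fun n => ?_
    rw [show n + D / 2 + 1 = n + K by omega, hh, neg_mul, Nat.cast_mul, Real.mul_rpow (by positivity) (by positivity)]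
    push_cast
    ring
  rw [E]
  rw [← S] at F
  simp only [Function.comp, hT]
  set X := ∑' i : ℕ, hh (i + K) * ((i + K : ℕ) : ℝ) ^ (-(2 * u))
  set Y := ∑ i ∈ Finset.range K, hh i * (i : ℝ) ^ (-(2 * u))
  set R := ∑' n, residueClass (1 : ZMod 2) n / (n : ℝ) ^ (2 * u)
  set p := (2 : ℝ) ^ (-(2 * u))
  have hX : X = (2 * Real.log 2 * R - Real.log 2 ^ 2) / (1 - p) - Y := by
    field_simp
    linarith
  rw [hX]
  field_simp
end

section
/- Let D be a positive even integer with D mod 6 ≠ 4, and let s be a complex number with Re(s) > 1/2. Then the series ∑_{ν=0}^∞ (−1)^ν · (D²/9)^ν · 3^{−2s} · C(−s,ν) · [ (1 − 2^{−2s−2ν})·ζ(2s+2ν) − ∑_{a=1}^{⌊D/6⌋} (2a−1)^{−2s−2ν} ] converges absolutely, and ∑_{a=⌊D/6⌋+1}^∞ (9(2a−1)² − D²)^{−s} equals this series, where C(−s,ν) = (−s)(−s−1)⋯(−s−ν+1)/ν! is the generalized binomial coefficient. -/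
lemma genBinom_eq_choose (s : ℂ) (n : ℕ) : genBinom s n = Ring.choose s n := by
  rw [Ring.choose_eq_smul, genBinom, Polynomial.descPochhammer_smeval_eq_ascPochhammer,
    Polynomial.ascPochhammer_smeval_cast, Polynomial.ascPochhammer_smeval_eq_eval,
    ← descPochhammer_eval_eq_ascPochhammer, descPochhammer_eval_eq_prod_range]
  simp [div_eq_inv_mul]

lemma hasSum_genBinom (s z : ℂ) (hz : ‖z‖ < 1) :
    HasSum (fun n => genBinom s n * z ^ n) ((1 + z) ^ s) := by
  have h := (Complex.one_add_cpow_hasFPowerSeriesOnBall_zero (a := s)).hasSum (y := z)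
    (by simpa [Metric.mem_eball, edist_zero_right, ← ofReal_norm] using hz)
  simpa [genBinom_eq_choose, binomialSeries, FormalMultilinearSeries.coeff_ofScalars,
    mul_comm] using h

lemma odd_summable (w : ℂ) (hw : 1 < w.re) :
    Summable (fun a : ℕ => ((2 * a + 1 : ℕ) : ℂ) ^ (-w)) := by
  have h := Complex.summable_one_div_nat_cpow.2 hw
  have h2 := h.comp_injective (i := fun a : ℕ => 2 * a + 1) (fun a b h => by simpa using h)
  simpa [Function.comp_def, Complex.cpow_neg] using h2

lemma odd_tsum (w : ℂ) (hw : 1 < w.re) (k : ℕ) :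
    ∑' a : ℕ, ((2 * (a + k + 1) - 1 : ℕ) : ℂ) ^ (-w) =
      (1 - (2 : ℂ) ^ (-w)) * riemannZeta w -
        ∑ a ∈ Finset.Icc 1 k, ((2 * a - 1 : ℕ) : ℂ) ^ (-w) := by
  have h := Complex.summable_one_div_nat_cpow.2 hw
  have hz : riemannZeta w = ∑' n : ℕ, (n : ℂ) ^ (-w) := by
    rw [zeta_eq_tsum_one_div_nat_cpow hw]; simp [Complex.cpow_neg]
  have h1 : Summable (fun n : ℕ => (n : ℂ) ^ (-w)) := by simpa [Complex.cpow_neg] using h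
  have heq : ∀ n : ℕ, ((2 * n : ℕ) : ℂ) ^ (-w) = 2 ^ (-w) * (n : ℂ) ^ (-w) := by
    intro n
    have := Complex.mul_cpow_ofReal_nonneg (a := 2) (b := n) (by norm_num) (by positivity) (-w)
    push_cast at this ⊢
    exact this
  have he : Summable (fun n : ℕ => ((2 * n : ℕ) : ℂ) ^ (-w)) := by
    simp_rw [heq]; exact h1.mul_left _
  have ho := odd_summable w hw
  have h3 := tsum_even_add_odd (f := fun n : ℕ => (n : ℂ) ^ (-w)) he ho
  simp_rw [heq] at h3
  rw [tsum_mul_left, ← hz] at h3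
  have h4 := ho.sum_add_tsum_nat_add k
  have h5 : ∑ a ∈ Finset.Icc 1 k, ((2 * a - 1 : ℕ) : ℂ) ^ (-w) =
      ∑ i ∈ Finset.range k, ((2 * i + 1 : ℕ) : ℂ) ^ (-w) := by
    rw [Finset.range_eq_Ico]
    have h7 := Finset.sum_Ico_add' (fun a : ℕ => ((2 * a - 1 : ℕ) : ℂ) ^ (-w)) 0 k 1
    exact h7.symm
  have h6 : ∀ a : ℕ, 2 * (a + k + 1) - 1 = 2 * (a + k) + 1 := fun a => by omega
  simp_rw [h6]
  rw [h5]
  linear_combination h4 + h3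

lemma cpow_split (m : ℕ) (hm : 0 < m) (s : ℂ) (ν : ℕ) :
    (m : ℂ) ^ (-(2 * s + 2 * (ν : ℂ))) = (m : ℂ) ^ (-(2 * s)) * (((m : ℂ) ^ 2)⁻¹) ^ ν := by
  have : (m : ℂ) ≠ 0 := by exact_mod_cast hm.ne'
  rw [neg_add, Complex.cpow_add _ _ this, Complex.cpow_neg _ (2 * (ν : ℂ)), inv_pow, ← pow_mul]
  congr 2
  exact_mod_cast Complex.cpow_natCast (m : ℂ) (2 * ν)

lemma term_expand (D m : ℕ) (hm : D < 3 * m) (s : ℂ) :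
    HasSum (fun ν : ℕ => (-1 : ℂ) ^ ν * ((D : ℂ) ^ 2 / 9) ^ ν * (3 : ℂ) ^ (-2 * s) *
        genBinom (-s) ν * (m : ℂ) ^ (-(2 * s + 2 * (ν : ℂ))))
      ((9 * (m : ℂ) ^ 2 - (D : ℂ) ^ 2) ^ (-s)) := by
  have hm0 : 0 < m := by omega
  have hmR : (0 : ℝ) < m := by exact_mod_cast hm0
  have hmC : (m : ℂ) ≠ 0 := by exact_mod_cast hm0.ne'
  have hlt : (D : ℝ) ^ 2 < 9 * (m : ℝ) ^ 2 := by
    have h1 : (D : ℝ) < 3 * m := by exact_mod_cast hm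
    have h0 : (0 : ℝ) ≤ D := D.cast_nonneg
    nlinarith
  set x : ℝ := (D : ℝ) ^ 2 / 9 * ((m : ℝ) ^ 2)⁻¹ with hx
  have hx0 : 0 ≤ x := by positivity
  have hx1 : x < 1 := by
    rw [hx, ← div_eq_mul_inv, div_lt_one (by positivity)]; linarith
  have hb := hasSum_genBinom (-s) (-(x : ℂ)) (by
    rw [norm_neg, Complex.norm_real, Real.norm_of_nonneg hx0]; exact hx1)
  have hsq : ∀ r : ℝ, 0 < r → ((r : ℂ) * r) ^ (-s) = (r : ℂ) ^ (-2 * s) := by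
    intro r hr
    have hr' : (r : ℂ) ≠ 0 := by exact_mod_cast hr.ne'
    rw [Complex.mul_cpow_ofReal_nonneg hr.le hr.le, ← Complex.cpow_add _ _ hr']
    congr 1; ring
  have hval : (9 * (m : ℂ) ^ 2 - (D : ℂ) ^ 2) ^ (-s) =
      (3 : ℂ) ^ (-2 * s) * (m : ℂ) ^ (-(2 * s)) * (1 + -(x : ℂ)) ^ (-s) := by
    have e1 : 9 * (m : ℂ) ^ 2 - (D : ℂ) ^ 2 =
        (((3 * m) * (3 * m) : ℝ) : ℂ) * ((1 - x : ℝ) : ℂ) := by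
      rw [hx]; push_cast; field_simp; ring
    rw [e1, Complex.mul_cpow_ofReal_nonneg (by positivity) (by linarith), Complex.ofReal_mul,
      hsq _ (by positivity), Complex.ofReal_mul,
      Complex.mul_cpow_ofReal_nonneg (by norm_num) hmR.le]
    push_cast
    rw [neg_mul, sub_eq_add_neg]
  rw [hval]
  refine (hb.mul_left ((3 : ℂ) ^ (-2 * s) * (m : ℂ) ^ (-(2 * s)))).congr_fun fun ν => ?_
  rw [cpow_split m hm0, hx]
  push_cast
  rw [neg_pow ((D : ℂ) ^ 2 / 9 * ((m : ℂ) ^ 2)⁻¹) ν, mul_pow]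
  ring

lemma double_summable (D k : ℕ) (hk : D < 3 * (2 * k + 1))
    (s : ℂ) (hs : 1 / 2 < s.re) :
    Summable (fun p : ℕ × ℕ => (-1 : ℂ) ^ p.1 * ((D : ℂ) ^ 2 / 9) ^ p.1 * (3 : ℂ) ^ (-2 * s) *
        genBinom (-s) p.1 * ((2 * (p.2 + k + 1) - 1 : ℕ) : ℂ) ^ (-(2 * s + 2 * (p.1 : ℂ)))) := by
  set x : ℝ := (D : ℝ) ^ 2 / 9 * (((2 * k + 1 : ℕ) : ℝ) ^ 2)⁻¹ with hx
  have hx0 : 0 ≤ x := by positivity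
  have hx1 : x < 1 := by
    have h1 : (D : ℝ) < 3 * ((2 * k + 1 : ℕ) : ℝ) := by exact_mod_cast hk
    have h0 : (0 : ℝ) ≤ D := D.cast_nonneg
    rw [hx, ← div_eq_mul_inv, div_lt_one (by positivity)]
    nlinarith
  have hb := (hasSum_genBinom (-s) (x : ℂ) (by
    rw [Complex.norm_real, Real.norm_of_nonneg hx0]; exact hx1)).summable.norm
  have ho := (odd_summable (2 * s) (by simp; linarith)).norm
  have ho' := (summable_nat_add_iff k).2 ho
  have hprod := ((hb.mul_left ‖(3 : ℂ) ^ (-2 * s)‖).mul_of_nonneg ho'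
    (fun _ => by positivity) (fun _ => norm_nonneg _))
  refine Summable.of_norm_bounded hprod ?_
  rintro ⟨ν, a⟩
  have h6 : 2 * (a + k + 1) - 1 = 2 * (a + k) + 1 := by omega
  simp only [h6]
  rw [cpow_split _ (by omega)]
  simp only [norm_mul, norm_pow, norm_neg, norm_one, one_pow, norm_div, norm_inv,
    Complex.norm_natCast, Complex.norm_real, Real.norm_of_nonneg hx0, one_mul]
  have h9 : ‖(9 : ℂ)‖ = 9 := by norm_num
  rw [h9]
  have hle : (D : ℝ) ^ 2 / 9 * (((2 * (a + k) + 1 : ℕ) : ℝ) ^ 2)⁻¹ ≤ x := by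
    rw [hx]
    gcongr
    omega
  have hpow := pow_le_pow_left₀ (by positivity) hle ν
  rw [mul_pow] at hpow
  calc _ = ‖(3 : ℂ) ^ (-2 * s)‖ * ‖genBinom (-s) ν‖ *
        ‖((2 * (a + k) + 1 : ℕ) : ℂ) ^ (-(2 * s))‖ *
        (((D : ℝ) ^ 2 / 9) ^ ν * ((((2 * (a + k) + 1 : ℕ) : ℝ) ^ 2)⁻¹) ^ ν) := by ring
    _ ≤ ‖(3 : ℂ) ^ (-2 * s)‖ * ‖genBinom (-s) ν‖ *
        ‖((2 * (a + k) + 1 : ℕ) : ℂ) ^ (-(2 * s))‖ * x ^ ν := by gcongr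
    _ = _ := by ring

theorem QD_expansion_even (D : ℕ) (hD : 0 < D) (heven : 2 ∣ D) (hmod : D % 6 ≠ 4)
    (s : ℂ) (hs : 1 / 2 < s.re) :
    Summable (fun ν : ℕ => ‖(-1 : ℂ) ^ ν * ((D : ℂ) ^ 2 / 9) ^ ν * (3 : ℂ) ^ (-2 * s) *
        genBinom (-s) ν *
        ((1 - (2 : ℂ) ^ (-(2 * s + 2 * (ν : ℂ)))) * riemannZeta (2 * s + 2 * (ν : ℂ)) -
          ∑ a ∈ Finset.Icc 1 (D / 6), ((2 * a - 1 : ℕ) : ℂ) ^ (-(2 * s + 2 * (ν : ℂ))))‖) ∧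
    ∑' a : ℕ, (9 * ((2 * (a + D / 6 + 1) - 1 : ℕ) : ℂ) ^ 2 - (D : ℂ) ^ 2) ^ (-s) =
      ∑' ν : ℕ, (-1 : ℂ) ^ ν * ((D : ℂ) ^ 2 / 9) ^ ν * (3 : ℂ) ^ (-2 * s) *
        genBinom (-s) ν *
        ((1 - (2 : ℂ) ^ (-(2 * s + 2 * (ν : ℂ)))) * riemannZeta (2 * s + 2 * (ν : ℂ)) -
          ∑ a ∈ Finset.Icc 1 (D / 6), ((2 * a - 1 : ℕ) : ℂ) ^ (-(2 * s + 2 * (ν : ℂ)))) := by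
  have hk : D < 3 * (2 * (D / 6) + 1) := by omega
  have hS := double_summable D (D / 6) hk s hs
  have ht : ∀ ν : ℕ, (1 - (2 : ℂ) ^ (-(2 * s + 2 * (ν : ℂ)))) * riemannZeta (2 * s + 2 * (ν : ℂ)) -
          ∑ a ∈ Finset.Icc 1 (D / 6), ((2 * a - 1 : ℕ) : ℂ) ^ (-(2 * s + 2 * (ν : ℂ))) =
      ∑' a : ℕ, ((2 * (a + D / 6 + 1) - 1 : ℕ) : ℂ) ^ (-(2 * s + 2 * (ν : ℂ))) := by
    intro ν
    rw [odd_tsum]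
    have : (0 : ℝ) ≤ ν := ν.cast_nonneg
    simp
    linarith
  simp_rw [ht, ← tsum_mul_left]
  constructor
  · exact hS.prod.norm
  · rw [← Summable.tsum_comm (f := fun (ν a : ℕ) => (-1 : ℂ) ^ ν * ((D : ℂ) ^ 2 / 9) ^ ν *
        (3 : ℂ) ^ (-2 * s) * genBinom (-s) ν *
        ((2 * (a + D / 6 + 1) - 1 : ℕ) : ℂ) ^ (-(2 * s + 2 * (ν : ℂ)))) hS]
    refine tsum_congr fun a => ?_
    exact ((term_expand D (2 * (a + D / 6 + 1) - 1) (by omega) s).tsum_eq).symm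
end

section
/- Let D be a positive even integer with D mod 6 ≠ 4 and let w be a complex number with Re(w) > 1/2. Then 3^{−2w} ∑_{n>⌊D/6⌋} (2n−1)^{−2w} ∑_{d ∣ 9(2n−1)²} μ(d)·(log d)² = −(log 3)²·[ (3^{2w}−1)^{−1} − ∑_{i≥0, 3^i ≤ 2⌊D/6⌋−1} 3^{−2(i+1)w} ] − 2·log 3·[ (3^{2w}−1)^{−1}·( ζ'(2w)/ζ(2w) + log 2/(2^{2w}−1) + log 3/(3^{2w}−1) ) + ∑_{(i,k,p)} (log p)·3^{−2(i+1)w}·p^{−2kw} ], where the sum ∑_{(i,k,p)} ranges over all triples with p a prime ≥ 5, i ≥ 0, k ≥ 1 and 3^i·p^k ≤ 2⌊D/6⌋−1. (Note ζ(2w) ≠ 0 and 2^{2w} ≠ 1, 3^{2w} ≠ 1 since Re(2w) > 1.) -/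
open ArithmeticFunction in
lemma aux_mulog2 (a R : ℕ) (hR : ¬ 3 ∣ R) :
    mulog2 (3 ^ (a + 1) * R) =
      -(Real.log 3) ^ 2 * (if R = 1 then 1 else 0) + 2 * Real.log 3 * vonMangoldt R := by
  have hR0 : R ≠ 0 := by rintro rfl; simp at hR
  have hmu : ∑ d ∈ R.divisors, (moebius d : ℝ) = if R = 1 then 1 else 0 := by
    have := congrArg (fun f : ArithmeticFunction ℤ => ((f R : ℤ) : ℝ)) moebius_mul_coe_zeta
    simp only [coe_mul_zeta_apply, one_apply] at this
    push_cast at this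
    exact this
  have hl : ∑ d ∈ R.divisors, (moebius d : ℝ) * Real.log d = -vonMangoldt R := by
    simpa [log_apply] using sum_moebius_mul_log_eq (n := R)
  have key : ∑ x ∈ Finset.range 2 ×ˢ R.divisors,
      ((moebius (3 ^ x.1 * x.2) : ℝ) * (Real.log ((3 ^ x.1 * x.2 : ℕ) : ℝ)) ^ 2) =
      mulog2 (3 ^ (a + 1) * R) := by
    unfold mulog2
    refine Finset.sum_of_injOn (fun x => 3 ^ x.1 * x.2) ?_ ?_ ?_ ?_
    · rintro ⟨i, d⟩ h1 ⟨j, e⟩ h2 h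
      simp only [Finset.coe_product, Set.mem_prod, Finset.mem_coe, Finset.mem_range,
        Nat.mem_divisors] at h1 h2 h
      have hd : ¬ 3 ∣ d := fun h => hR (h.trans h1.2.1)
      have he : ¬ 3 ∣ e := fun h => hR (h.trans h2.2.1)
      obtain ⟨h1, -⟩ := h1
      obtain ⟨h2, -⟩ := h2
      interval_cases i <;> interval_cases j <;> simp at h ⊢ <;> omega
    · rintro ⟨i, d⟩ h1
      simp only [Finset.coe_product, Set.mem_prod, Finset.mem_coe, Finset.mem_range,
        Nat.mem_divisors] at h1 ⊢
      refine ⟨mul_dvd_mul (pow_dvd_pow _ (by omega)) h1.2.1, by positivity⟩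
    · intro d hd hn
      have hd0 : d ≠ 0 := (Nat.pos_of_mem_divisors hd).ne'
      obtain ⟨j, e, he, rfl⟩ := Nat.exists_eq_pow_mul_and_not_dvd hd0 3 (by norm_num)
      have hco : Nat.Coprime e (3 ^ (a + 1)) :=
        (((Nat.Prime.coprime_iff_not_dvd Nat.prime_three).2 he).symm).pow_right _
      have heR : e ∣ R := hco.dvd_of_dvd_mul_left ((Dvd.intro_left _ rfl).trans (Nat.mem_divisors.1 hd).1)
      have hj : 2 ≤ j := by
        by_contra hj
        exact hn ⟨(j, e), by simp [heR, hR0]; omega, rfl⟩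
      rw [moebius_eq_zero_of_not_squarefree]
      · simp
      · intro hs
        have := hs 3 (by
          refine Dvd.dvd.mul_right ?_ e
          rw [← pow_two]; exact pow_dvd_pow _ hj)
        simp at this
    · intro x hx; rfl
  rw [← key, Finset.sum_product, Finset.sum_range_succ, Finset.sum_range_one, ← Finset.sum_add_distrib]
  have : ∀ d ∈ R.divisors, ((moebius (3 ^ 0 * d) : ℝ) * (Real.log ((3 ^ 0 * d : ℕ) : ℝ)) ^ 2) +
      ((moebius (3 ^ 1 * d) : ℝ) * (Real.log ((3 ^ 1 * d : ℕ) : ℝ)) ^ 2) =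
      -(Real.log 3) ^ 2 * (moebius d : ℝ) + (-2 * Real.log 3) * ((moebius d : ℝ) * Real.log d) := by
    intro d hd
    have hd0 : (d : ℝ) ≠ 0 := by exact_mod_cast (Nat.pos_of_mem_divisors hd).ne'
    have hc : Nat.Coprime 3 d := (Nat.Prime.coprime_iff_not_dvd Nat.prime_three).2
      fun h => hR (h.trans (Nat.mem_divisors.1 hd).1)
    rw [pow_one, pow_zero, one_mul, isMultiplicative_moebius.map_mul_of_coprime hc,
      moebius_apply_prime Nat.prime_three]
    push_cast
    rw [Real.log_mul (by norm_num) hd0]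
    ring
  rw [Finset.sum_congr rfl this, Finset.sum_add_distrib, ← Finset.mul_sum, ← Finset.mul_sum, hmu, hl]
  ring

/-- the part of `m` prime to `3` -/
def q3 (m : ℕ) : ℕ := m / 3 ^ m.factorization 3

lemma q3_mul (i r : ℕ) (hr : ¬ 3 ∣ r) : q3 (3 ^ i * r) = r := by
  have hr0 : r ≠ 0 := by rintro rfl; simp at hr
  have : (3 ^ i * r).factorization 3 = i := by
    rw [Nat.factorization_mul (by positivity) hr0, Nat.Prime.factorization_pow Nat.prime_three]
    simp [Nat.factorization_eq_zero_of_not_dvd hr]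
  unfold q3
  rw [this]
  exact Nat.mul_div_cancel_left _ (by positivity)

lemma mulog2_nine (m : ℕ) (hm : m ≠ 0) :
    mulog2 (9 * m ^ 2) = -(Real.log 3) ^ 2 * (if q3 m = 1 then 1 else 0)
      + 2 * Real.log 3 * ArithmeticFunction.vonMangoldt (q3 m) := by
  obtain ⟨i, r, hr, rfl⟩ := Nat.exists_eq_pow_mul_and_not_dvd hm 3 (by norm_num)
  rw [q3_mul i r hr]
  have : 9 * (3 ^ i * r) ^ 2 = 3 ^ (2 * i + 1 + 1) * r ^ 2 := by ring
  rw [this, aux_mulog2 _ _ (fun h => hr (Nat.prime_three.dvd_of_dvd_pow h)),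
    ArithmeticFunction.vonMangoldt_apply_pow (by norm_num)]
  simp

lemma c_mul (s : ℂ) (a b : ℕ) : ((a * b : ℕ) : ℂ) ^ s = (a : ℂ) ^ s * (b : ℂ) ^ s := by
  push_cast
  exact Complex.natCast_mul_natCast_cpow a b s

lemma c_pow (s : ℂ) (a k : ℕ) : ((a ^ k : ℕ) : ℂ) ^ s = ((a : ℂ) ^ s) ^ k := by
  induction k with
  | zero => simp
  | succ k ih => rw [pow_succ, c_mul, ih, pow_succ]

lemma c_norm (s : ℂ) (hs : 1 < s.re) (p : ℕ) (hp : 2 ≤ p) : ‖((p : ℂ) ^ s)⁻¹‖ < 1 := by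
  rw [norm_inv, Complex.norm_natCast_cpow_of_pos (by omega)]
  apply inv_lt_one_of_one_lt₀
  exact Real.one_lt_rpow (by exact_mod_cast hp) (by linarith)

lemma c_ne (s : ℂ) (p : ℕ) (hp : 2 ≤ p) : (p : ℂ) ^ s ≠ 0 := by
  rw [Complex.cpow_ne_zero_iff]; left; exact_mod_cast (by omega : p ≠ 0)

lemma c_ne1 (s : ℂ) (hs : 1 < s.re) (p : ℕ) (hp : 2 ≤ p) : (p : ℂ) ^ s - 1 ≠ 0 := by
  intro h
  have := c_norm s hs p hp
  rw [sub_eq_zero.1 h] at this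
  simp at this

lemma hs_congr {ι : Type*} {f g : ι → ℂ} {a b : ℂ} (h : HasSum f a) (hf : ∀ x, g x = f x)
    (hab : b = a) : HasSum g b := by
  have : g = f := funext hf
  rw [this, hab]
  exact h

lemma geo (s : ℂ) (hs : 1 < s.re) (p : ℕ) (hp : 2 ≤ p) :
    HasSum (fun k : ℕ => (((p : ℂ) ^ s)⁻¹) ^ (k + 1)) (((p : ℂ) ^ s - 1)⁻¹) := by
  have h := (hasSum_geometric_of_norm_lt_one (c_norm s hs p hp)).mul_left (((p : ℂ) ^ s)⁻¹)
  have h1 := c_ne s p hp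
  have h2 := c_ne1 s hs p hp
  refine hs_congr h ?_ ?_
  · intro k; rw [pow_succ]; ring
  · rw [← mul_inv]
    congr 1
    field_simp

/-- term of the Dirichlet series of the von Mangoldt function -/
noncomputable def xt (s : ℂ) (m : ℕ) : ℂ :=
  (ArithmeticFunction.vonMangoldt m : ℂ) * ((m : ℂ) ^ s)⁻¹

lemma xt_sum (s : ℂ) (hs : 1 < s.re) :
    HasSum (xt s) (-deriv riemannZeta s / riemannZeta s) := by
  have h1 := (ArithmeticFunction.LSeriesSummable_vonMangoldt hs).LSeriesHasSum
  rw [ArithmeticFunction.LSeries_vonMangoldt_eq_deriv_riemannZeta_div hs] at h1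
  rw [LSeriesHasSum] at h1
  refine hs_congr h1 ?_ rfl
  intro m
  rcases eq_or_ne m 0 with rfl | hm
  · simp [xt]
  · rw [LSeries.term_of_ne_zero hm, xt, div_eq_mul_inv]

lemma vm_primepow {p m : ℕ} (hp : p.Prime) (hd : p ∣ m) (h : ArithmeticFunction.vonMangoldt m ≠ 0) :
    ∃ k, m = p ^ (k + 1) := by
  rw [ArithmeticFunction.vonMangoldt_ne_zero_iff, isPrimePow_nat_iff] at h
  obtain ⟨l, k, hl, hk, rfl⟩ := h
  have := (Nat.prime_dvd_prime_iff_eq hp hl).1 (hp.dvd_of_dvd_pow hd)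
  subst this
  exact ⟨k - 1, by rw [Nat.sub_add_cancel hk]⟩

lemma xt_sum_p (s : ℂ) (hs : 1 < s.re) (p : ℕ) (hp : p.Prime) :
    HasSum (fun m => if p ∣ m then xt s m else 0) ((Real.log p : ℂ) / ((p : ℂ) ^ s - 1)) := by
  have hinj : Function.Injective (fun k : ℕ => p ^ (k + 1)) := by
    intro a b h
    have := Nat.pow_right_injective hp.two_le h
    omega
  rw [← hinj.hasSum_iff]
  · have := (geo s hs p hp.two_le).mul_left (Real.log p : ℂ)
    rw [div_eq_mul_inv]
    refine hs_congr this ?_ rfl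
    intro k
    simp only [Function.comp, xt]
    rw [if_pos (dvd_pow_self _ (by omega)), ArithmeticFunction.vonMangoldt_apply_pow (by omega),
      ArithmeticFunction.vonMangoldt_apply_prime hp, c_pow, inv_pow]
  · intro m hm
    split_ifs with h
    · by_contra hx
      obtain ⟨k, rfl⟩ := vm_primepow hp h (fun h0 => hx (by simp [xt, h0]))
      exact hm ⟨k, rfl⟩
    · rfl

/-- numbers prime to six -/
def S6 : Set ℕ := {m | ¬ 2 ∣ m ∧ ¬ 3 ∣ m}

lemma xt_sum6 (s : ℂ) (hs : 1 < s.re) :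
    HasSum (fun m : S6 => xt s m) (-(deriv riemannZeta s / riemannZeta s +
      (Real.log 2 : ℂ) / ((2 : ℂ) ^ s - 1) + (Real.log 3 : ℂ) / ((3 : ℂ) ^ s - 1))) := by
  have h := ((xt_sum s hs).sub (xt_sum_p s hs 2 Nat.prime_two)).sub (xt_sum_p s hs 3 Nat.prime_three)
  have := (hasSum_subtype_iff_indicator (s := S6) (f := xt s) (a := -(deriv riemannZeta s / riemannZeta s +
      (Real.log 2 : ℂ) / ((2 : ℂ) ^ s - 1) + (Real.log 3 : ℂ) / ((3 : ℂ) ^ s - 1)))).2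
  apply this
  refine hs_congr h ?_ ?_
  · intro m
    have hm : m ∈ S6 ↔ ¬ 2 ∣ m ∧ ¬ 3 ∣ m := Iff.rfl
    by_cases h2 : 2 ∣ m <;> by_cases h3 : 3 ∣ m <;>
      simp only [Set.indicator, hm, h2, h3, if_true, if_false, not_true, not_false_iff, and_true,
        and_false, sub_self, sub_zero, zero_sub]
    rw [zero_eq_neg]
    by_contra hx
    have hx : xt s m ≠ 0 := hx
    have hv : ArithmeticFunction.vonMangoldt m ≠ 0 := (fun h0 => hx (by simp [xt, h0]))
    obtain ⟨k, rfl⟩ := vm_primepow Nat.prime_two h2 hv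
    have := Nat.prime_three.dvd_of_dvd_pow h3
    omega
  · push_cast
    ring

lemma odd3 (i r : ℕ) (hr : ¬ 2 ∣ r) : 2 * (3 ^ i * r / 2) + 1 = 3 ^ i * r := by
  have : Odd (3 ^ i * r) := (Odd.pow (by decide)).mul (by rw [← Nat.not_even_iff_odd, even_iff_two_dvd]; exact hr)
  obtain ⟨k, hk⟩ := this
  omega

lemma pow3_inj {i j r t : ℕ} (hr : ¬ 3 ∣ r) (ht : ¬ 3 ∣ t) (h : 3 ^ i * r = 3 ^ j * t) :
    i = j ∧ r = t := by
  have h1 : r = t := by rw [← q3_mul i r hr, h, q3_mul j t ht]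
  subst h1
  have hr0 : 0 < r := by rcases Nat.eq_zero_or_pos r with rfl | h; simp at hr; exact h
  exact ⟨Nat.pow_right_injective (le_of_eq_of_le rfl (by norm_num)) (Nat.eq_of_mul_eq_mul_right hr0 h), rfl⟩

lemma dec3 (n : ℕ) : ∃ i r, ¬ 2 ∣ r ∧ ¬ 3 ∣ r ∧ 2 * n + 1 = 3 ^ i * r := by
  obtain ⟨i, r, hr, h⟩ := Nat.exists_eq_pow_mul_and_not_dvd (n := 2 * n + 1) (by omega) 3 (by norm_num)
  refine ⟨i, r, fun h2 => ?_, hr, h⟩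
  have : 2 ∣ 2 * n + 1 := h ▸ h2.mul_left _
  omega

noncomputable def F1 (s : ℂ) (n : ℕ) : ℂ :=
  (if q3 (2 * n + 1) = 1 then 1 else 0) * (((2 * n + 1 : ℕ) : ℂ) ^ s)⁻¹
noncomputable def F2 (s : ℂ) (n : ℕ) : ℂ :=
  (ArithmeticFunction.vonMangoldt (q3 (2 * n + 1)) : ℂ) * (((2 * n + 1 : ℕ) : ℂ) ^ s)⁻¹

lemma F1_sum (s : ℂ) (hs : 1 < s.re) :
    HasSum (fun n => ((3 : ℂ) ^ s)⁻¹ * F1 s n) (((3 : ℂ) ^ s - 1)⁻¹) := by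
  have hinj : Function.Injective (fun k : ℕ => 3 ^ k * 1 / 2) := by
    intro a b h
    have ha := odd3 a 1 (by norm_num)
    have hb := odd3 b 1 (by norm_num)
    have h : 3 ^ a * 1 / 2 = 3 ^ b * 1 / 2 := h
    exact (pow3_inj (by norm_num) (by norm_num) (by omega : 3 ^ a * 1 = 3 ^ b * 1)).1
  rw [← hinj.hasSum_iff]
  · have := geo s hs 3 (by norm_num)
    refine hs_congr this ?_ (by norm_num)
    intro k
    simp only [Function.comp, F1]
    rw [odd3 k 1 (by norm_num), q3_mul k 1 (by norm_num), if_pos rfl, mul_one, c_pow, inv_pow, pow_succ]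
    push_cast
    rw [mul_inv, one_mul, mul_comm]
  · intro n hn
    obtain ⟨i, r, h2, h3, h⟩ := dec3 n
    have : q3 (2 * n + 1) ≠ 1 := by
      rw [h, q3_mul i r h3]
      rintro rfl
      exact hn ⟨i, by have := odd3 i 1 h2; simp only; omega⟩
    simp [F1, this]

lemma F2_sum (s : ℂ) (hs : 1 < s.re) :
    HasSum (fun n => ((3 : ℂ) ^ s)⁻¹ * F2 s n) (((3 : ℂ) ^ s - 1)⁻¹ *
    (-(deriv riemannZeta s / riemannZeta s +
      (Real.log 2 : ℂ) / ((2 : ℂ) ^ s - 1) + (Real.log 3 : ℂ) / ((3 : ℂ) ^ s - 1)))) := by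
  have hinj : Function.Injective (fun x : ℕ × S6 => 3 ^ x.1 * (x.2 : ℕ) / 2) := by
    rintro ⟨i, r, hr⟩ ⟨j, t, ht⟩ h
    have ha := odd3 i r hr.1
    have hb := odd3 j t ht.1
    have h : 3 ^ i * r / 2 = 3 ^ j * t / 2 := h
    obtain ⟨rfl, rfl⟩ := pow3_inj hr.2 ht.2 (by omega : 3 ^ i * r = 3 ^ j * t)
    rfl
  rw [← hinj.hasSum_iff]
  · have h1 := geo s hs 3 (by norm_num)
    have h2 := xt_sum6 s hs
    have hsm : Summable (fun x : ℕ × S6 => (((3 : ℕ) : ℂ) ^ s)⁻¹ ^ (x.1 + 1) * xt s x.2) :=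
      summable_mul_of_summable_norm (f := fun k : ℕ => (((3 : ℕ) : ℂ) ^ s)⁻¹ ^ (k + 1))
        (g := fun m : S6 => xt s m) h1.summable.norm h2.summable.norm
    have := HasSum.mul (f := fun k : ℕ => (((3 : ℕ) : ℂ) ^ s)⁻¹ ^ (k + 1))
        (g := fun m : S6 => xt s m) h1 h2 hsm
    refine hs_congr this ?_ (by norm_num)
    rintro ⟨i, r, hr⟩
    simp only [Function.comp, F2, xt]
    rw [odd3 i r hr.1, q3_mul i r hr.2, c_mul, c_pow, inv_pow, pow_succ]
    push_cast
    simp only [mul_inv]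
    ring
  · intro n hn
    obtain ⟨i, r, h2, h3, h⟩ := dec3 n
    have ho := odd3 i r h2
    have he : 3 ^ i * r / 2 = n := by omega
    exact (hn ⟨(i, (⟨r, h2, h3⟩ : S6)), he⟩).elim

lemma F1_fin (w : ℂ) (N : ℕ) :
    ∑ i ∈ (Finset.range (2 * N - 1 + 1)).filter (fun i => 3 ^ i ≤ 2 * N - 1),
          (3 : ℂ) ^ (-2 * ((i : ℂ) + 1) * w) =
    ∑ n ∈ Finset.range N, ((3 : ℂ) ^ (2 * w))⁻¹ * F1 (2 * w) n := by
  refine Finset.sum_of_injOn (fun k => 3 ^ k * 1 / 2) ?_ ?_ ?_ ?_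
  · intro a _ b _ h
    have ha := odd3 a 1 (by norm_num)
    have hb := odd3 b 1 (by norm_num)
    have h : 3 ^ a * 1 / 2 = 3 ^ b * 1 / 2 := h
    exact (pow3_inj (by norm_num) (by norm_num) (by omega : 3 ^ a * 1 = 3 ^ b * 1)).1
  · intro i hi
    have ha := odd3 i 1 (by norm_num)
    simp only [Finset.coe_filter, Set.mem_ofPred_eq, Finset.mem_range, Finset.coe_range, Set.mem_Iio] at hi ⊢
    omega
  · intro n hn hx
    obtain ⟨i, r, h2, h3, h⟩ := dec3 n
    have : q3 (2 * n + 1) ≠ 1 := by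
      rw [h, q3_mul i r h3]
      rintro rfl
      refine hx ⟨i, ?_, by have := odd3 i 1 h2; simp only; omega⟩
      have := Nat.lt_pow_self (n := i) (by norm_num : 1 < 3)
      simp only [Finset.coe_filter, Set.mem_ofPred_eq, Finset.mem_range] at hn ⊢
      omega
    simp [F1, this]
  · intro k hk
    simp only [F1]
    rw [odd3 k 1 (by norm_num), q3_mul k 1 (by norm_num), if_pos rfl, mul_one, c_pow, one_mul,
      show -2 * ((k : ℂ) + 1) * w = -(((k + 1 : ℕ) : ℂ) * (2 * w)) by push_cast; ring,
      Complex.cpow_neg, Complex.cpow_nat_mul, pow_succ, mul_inv, mul_comm]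
    push_cast
    rfl

lemma F2_fin (w : ℂ) (N : ℕ) :
    ∑ x ∈ (Finset.range (2 * N - 1 + 1) ×ˢ Finset.range (2 * N - 1 + 1) ×ˢ
            Finset.range (2 * N - 1 + 1)).filter
            (fun x => Nat.Prime x.2.2 ∧ 5 ≤ x.2.2 ∧ 1 ≤ x.2.1 ∧
              3 ^ x.1 * x.2.2 ^ x.2.1 ≤ 2 * N - 1),
          (Real.log x.2.2 : ℂ) * (3 : ℂ) ^ (-2 * ((x.1 : ℂ) + 1) * w) *
            (x.2.2 : ℂ) ^ (-2 * (x.2.1 : ℂ) * w) =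
    ∑ n ∈ Finset.range N, ((3 : ℂ) ^ (2 * w))⁻¹ * F2 (2 * w) n := by
  have aux : ∀ p k : ℕ, p.Prime → 5 ≤ p → ¬ 2 ∣ p ^ k ∧ ¬ 3 ∣ p ^ k := by
    intro p k hp h5
    constructor
    · intro h
      have := (Nat.prime_dvd_prime_iff_eq Nat.prime_two hp).1 (Nat.prime_two.dvd_of_dvd_pow h)
      omega
    · intro h
      have := (Nat.prime_dvd_prime_iff_eq Nat.prime_three hp).1 (Nat.prime_three.dvd_of_dvd_pow h)
      omega
  refine Finset.sum_of_injOn (fun x => 3 ^ x.1 * x.2.2 ^ x.2.1 / 2) ?_ ?_ ?_ ?_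
  · rintro ⟨i, k, p⟩ h1 ⟨j, l, t⟩ h2 h
    simp only [Finset.coe_filter, Set.mem_ofPred_eq] at h1 h2 h
    obtain ⟨-, hp, hp5, hk, -⟩ := h1
    obtain ⟨-, ht, ht5, hl, -⟩ := h2
    have ha := odd3 i _ (aux p k hp hp5).1
    have hb := odd3 j _ (aux t l ht ht5).1
    obtain ⟨rfl, he⟩ := pow3_inj (aux p k hp hp5).2 (aux t l ht ht5).2
      (by omega : 3 ^ i * p ^ k = 3 ^ j * t ^ l)
    have hpt : p = t := (Nat.prime_dvd_prime_iff_eq hp ht).1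
      (hp.dvd_of_dvd_pow (he ▸ dvd_pow_self p (by omega : k ≠ 0)))
    subst hpt
    have := Nat.pow_right_injective hp.two_le he
    subst this
    rfl
  · rintro ⟨i, k, p⟩ h1
    simp only [Finset.coe_filter, Set.mem_ofPred_eq, Finset.coe_range, Set.mem_Iio] at h1 ⊢
    obtain ⟨-, hp, hp5, hk, hle⟩ := h1
    have ha := odd3 i _ (aux p k hp hp5).1
    omega
  · intro n hn hx
    obtain ⟨i, r, h2, h3, h⟩ := dec3 n
    have : ArithmeticFunction.vonMangoldt (q3 (2 * n + 1)) = 0 := by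
      rw [h, q3_mul i r h3]
      by_contra hv
      rw [← ne_eq, ArithmeticFunction.vonMangoldt_ne_zero_iff, isPrimePow_nat_iff] at hv
      obtain ⟨p, k, hp, hk, rfl⟩ := hv
      have hp2 : p ≠ 2 := by rintro rfl; exact h2 (dvd_pow_self _ (by omega))
      have hp3 : p ≠ 3 := by rintro rfl; exact h3 (dvd_pow_self _ (by omega))
      have hp4 : p ≠ 4 := by rintro rfl; exact absurd hp (by norm_num)
      have := hp.two_le
      have hodd := odd3 i _ h2
      refine hx ⟨(i, k, p), ?_, by simp only; omega⟩
      have e1 := Nat.lt_pow_self (n := i) (by norm_num : 1 < 3)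
      have e2 := Nat.lt_pow_self (n := k) hp.one_lt
      have e3 : p ≤ p ^ k := Nat.le_self_pow (by omega) p
      have e4 : 3 ^ i ≤ 3 ^ i * p ^ k := Nat.le_mul_of_pos_right _ (by omega)
      have e5 : p ^ k ≤ 3 ^ i * p ^ k := Nat.le_mul_of_pos_left _ (by omega)
      simp only [Finset.coe_filter, Set.mem_ofPred_eq, Finset.mem_range, Finset.mem_product] at hn ⊢
      refine ⟨⟨?_, ?_, ?_⟩, hp, ?_, hk, ?_⟩ <;> omega
    simp [F2, this]
  · rintro ⟨i, k, p⟩ h1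
    simp only [Finset.mem_filter] at h1
    obtain ⟨-, hp, hp5, hk, -⟩ := h1
    simp only [F2]
    rw [odd3 i _ (aux p k hp hp5).1, q3_mul i _ (aux p k hp hp5).2, c_mul, c_pow, c_pow,
      ArithmeticFunction.vonMangoldt_apply_pow (by omega), ArithmeticFunction.vonMangoldt_apply_prime hp,
      show -2 * ((i : ℂ) + 1) * w = -(((i + 1 : ℕ) : ℂ) * (2 * w)) by push_cast; ring,
      show -2 * (k : ℂ) * w = -((k : ℂ) * (2 * w)) by ring,
      Complex.cpow_neg, Complex.cpow_nat_mul, Complex.cpow_neg, Complex.cpow_nat_mul, pow_succ]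
    push_cast
    simp only [mul_inv]
    ring

theorem A_closed_form_even (D : ℕ) (hD : 0 < D) (heven : 2 ∣ D) (hmod : D % 6 ≠ 4)
    (w : ℂ) (hw : 1 / 2 < w.re) :
    (3 : ℂ) ^ (-2 * w) * (∑' n : ℕ, (mulog2 (9 * (2 * (n + D / 6 + 1) - 1) ^ 2) : ℂ) /
        ((2 * (n + D / 6 + 1) - 1 : ℕ) : ℂ) ^ (2 * w)) =
      -(Real.log 3 : ℂ) ^ 2 * (((3 : ℂ) ^ (2 * w) - 1)⁻¹ -
        ∑ i ∈ (Finset.range (2 * (D / 6) - 1 + 1)).filter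
            (fun i => 3 ^ i ≤ 2 * (D / 6) - 1),
          (3 : ℂ) ^ (-2 * ((i : ℂ) + 1) * w)) -
      2 * (Real.log 3 : ℂ) * (((3 : ℂ) ^ (2 * w) - 1)⁻¹ *
          (deriv riemannZeta (2 * w) / riemannZeta (2 * w) +
            (Real.log 2 : ℂ) / ((2 : ℂ) ^ (2 * w) - 1) +
            (Real.log 3 : ℂ) / ((3 : ℂ) ^ (2 * w) - 1)) +
        ∑ x ∈ (Finset.range (2 * (D / 6) - 1 + 1) ×ˢ Finset.range (2 * (D / 6) - 1 + 1) ×ˢ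
            Finset.range (2 * (D / 6) - 1 + 1)).filter
            (fun x => Nat.Prime x.2.2 ∧ 5 ≤ x.2.2 ∧ 1 ≤ x.2.1 ∧
              3 ^ x.1 * x.2.2 ^ x.2.1 ≤ 2 * (D / 6) - 1),
          (Real.log x.2.2 : ℂ) * (3 : ℂ) ^ (-2 * ((x.1 : ℂ) + 1) * w) *
            (x.2.2 : ℂ) ^ (-2 * (x.2.1 : ℂ) * w)) := by
  have hs : 1 < (2 * w).re := by simp; linarith
  have H1 := F1_sum (2 * w) hs
  have H2 := F2_sum (2 * w) hs
  rw [F1_fin, F2_fin]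
  generalize D / 6 = N
  have e1 := H1.summable.sum_add_tsum_nat_add N
  have e2 := H2.summable.sum_add_tsum_nat_add N
  rw [H1.tsum_eq] at e1
  rw [H2.tsum_eq] at e2
  have s1 := (summable_nat_add_iff N).2 H1.summable
  have s2 := (summable_nat_add_iff N).2 H2.summable
  have hterm : ∀ n : ℕ, (3 : ℂ) ^ (-2 * w) * ((mulog2 (9 * (2 * (n + N + 1) - 1) ^ 2) : ℂ) /
        ((2 * (n + N + 1) - 1 : ℕ) : ℂ) ^ (2 * w)) =
      -(Real.log 3 : ℂ) ^ 2 * (((3 : ℂ) ^ (2 * w))⁻¹ * F1 (2 * w) (n + N)) +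
      2 * (Real.log 3 : ℂ) * (((3 : ℂ) ^ (2 * w))⁻¹ * F2 (2 * w) (n + N)) := by
    intro n
    rw [show 2 * (n + N + 1) - 1 = 2 * (n + N) + 1 by omega, mulog2_nine _ (by omega),
      show -2 * w = -(2 * w) by ring, Complex.cpow_neg, F1, F2]
    split_ifs <;> push_cast <;> ring
  rw [← tsum_mul_left, tsum_congr hterm, (s1.mul_left _).tsum_add (s2.mul_left _),
    tsum_mul_left (a := -(Real.log 3 : ℂ) ^ 2), tsum_mul_left (a := 2 * (Real.log 3 : ℂ))]
  linear_combination (-(Real.log 3 : ℂ) ^ 2) * e1 + 2 * (Real.log 3 : ℂ) * e2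
end

section
/- Let D be a positive even integer with D mod 6 ≠ 4. Then, as the real number u tends to 1/2 from above, (u − 1/2) · 3^{−2u} ∑_{n>⌊D/6⌋} (2n−1)^{−2u} ∑_{d ∣ 9(2n−1)²} μ(d)·(log d)² tends to (log 3)/2. In other words, the asymptotic Dirichlet series A for even D has a simple pole at w = 1/2 with positive residue (log 3)/2. -/
open ArithmeticFunction ArithmeticFunction.vonMangoldt Filter Topology

lemma mulog2_of_dvd {M N : ℕ} (hM : M ≠ 0) (h : N ∣ M)
    (h2 : ∀ d, Squarefree d → d ∣ M → d ∣ N) : mulog2 M = mulog2 N := by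
  unfold mulog2
  symm
  apply Finset.sum_subset (Nat.divisors_subset_of_dvd hM h)
  intro d hd hd'
  have hN : N ≠ 0 := by rintro rfl; exact hM (by simpa using h)
  have : ¬ Squarefree d := fun hs => hd' (by
    rw [Nat.mem_divisors]; exact ⟨h2 d hs (Nat.dvd_of_mem_divisors hd), hN⟩)
  simp [moebius_eq_zero_of_not_squarefree this]

lemma mulog2_three_mul {m : ℕ} (hm : m ≠ 0) : mulog2 (9 * (3 * m) ^ 2) = mulog2 (9 * m ^ 2) := by
  apply mulog2_of_dvd (by positivity) ⟨9, by ring⟩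
  intro d hd h
  have : d ∣ (9 * m) ^ 2 := by convert h using 1; ring
  rw [hd.dvd_pow_iff_dvd (by norm_num)] at this
  exact this.trans ⟨m, by ring⟩

lemma mulog2_red {m : ℕ} (hm : m ≠ 0) : mulog2 (9 * m ^ 2) = mulog2 (3 * m) := by
  apply mulog2_of_dvd (by positivity) ⟨3 * m, by ring⟩
  intro d hd h
  have : d ∣ (3 * m) ^ 2 := by convert h using 1; ring
  rwa [hd.dvd_pow_iff_dvd (by norm_num)] at this

lemma divisors_three_mul {m : ℕ} (h3 : Nat.Coprime 3 m) :
    (3 * m).divisors = m.divisors.disjUnion (m.divisors.map ⟨fun d => 3 * d, fun a b h => by simpa using h⟩)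
    (by
      rw [Finset.disjoint_left]
      intro d hd h
      simp only [Finset.mem_map] at h
      obtain ⟨a, _, rfl⟩ := h
      have : 3 ∣ m := (Dvd.intro _ rfl).trans (Nat.dvd_of_mem_divisors hd)
      have := Nat.dvd_gcd (dvd_refl 3) this
      rw [h3] at this
      omega) := by
  have h0 : m ≠ 0 := by rintro rfl; simp at h3
  rw [Nat.divisors_mul, Nat.Prime.divisors Nat.prime_three]
  ext d
  simp only [Finset.mem_mul, Finset.mem_disjUnion, Finset.mem_map, Finset.mem_insert, Finset.mem_singleton]
  aesop

lemma mulog2_coprime {m : ℕ} (h3 : Nat.Coprime 3 m) :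
    mulog2 (9 * m ^ 2) = 2 * Real.log 3 * vonMangoldt m - if m = 1 then Real.log 3 ^ 2 else 0 := by
  have h0 : m ≠ 0 := by rintro rfl; simp at h3
  rw [mulog2_red h0, mulog2, divisors_three_mul h3, Finset.sum_disjUnion, Finset.sum_map,
    ← Finset.sum_add_distrib]
  have h1 : ∑ d ∈ m.divisors, (moebius d : ℝ) = if m = 1 then 1 else 0 := by
    have := congrArg (fun f => f m) (coe_moebius_mul_coe_zeta (R := ℝ))
    simp only [coe_mul_zeta_apply, intCoe_apply, one_apply] at this
    exact this
  have h2 : ∑ d ∈ m.divisors, (moebius d : ℝ) * Real.log d = -vonMangoldt m :=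
    sum_moebius_mul_log_eq
  calc _ = ∑ d ∈ m.divisors, (-(2 * Real.log 3) * ((moebius d : ℝ) * Real.log d) - Real.log 3 ^ 2 * moebius d) := by
        apply Finset.sum_congr rfl
        intro d hd
        have hd0 : d ≠ 0 := (Nat.pos_of_mem_divisors hd).ne'
        have hc : Nat.Coprime 3 d := h3.coprime_dvd_right (Nat.dvd_of_mem_divisors hd)
        change (moebius d : ℝ) * Real.log d ^ 2 + (moebius (3 * d) : ℝ) * Real.log ((3 * d : ℕ) : ℝ) ^ 2 = _
        rw [isMultiplicative_moebius.map_mul_of_coprime hc, moebius_apply_prime Nat.prime_three]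
        push_cast
        rw [Real.log_mul (by norm_num) (by positivity)]
        ring
    _ = _ := by
        rw [Finset.sum_sub_distrib, ← Finset.mul_sum, ← Finset.mul_sum, h1, h2]
        split_ifs <;> ring

lemma mulog2_bound (m : ℕ) (hm : m ≠ 0) :
    |mulog2 (9 * m ^ 2)| ≤ 2 * Real.log 3 * Real.log m + Real.log 3 ^ 2 := by
  have hl : 0 < Real.log 3 := Real.log_pos (by norm_num)
  induction m using Nat.strong_induction_on with
  | _ m ih =>
    by_cases h3 : 3 ∣ m
    · obtain ⟨k, rfl⟩ := h3
      have hk : k ≠ 0 := by rintro rfl; simp at hm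
      rw [mulog2_three_mul hk]
      refine (ih k (by omega) hk).trans ?_
      have : Real.log k ≤ Real.log ((3 * k : ℕ) : ℝ) :=
        Real.log_le_log (by positivity) (by exact_mod_cast (by omega))
      nlinarith
    · rw [mulog2_coprime ((Nat.Prime.coprime_iff_not_dvd Nat.prime_three).2 h3)]
      have h1 : vonMangoldt m ≤ Real.log m := vonMangoldt_le_log
      have h2 : 0 ≤ vonMangoldt m := vonMangoldt_nonneg
      rw [abs_le]
      split_ifs <;> constructor <;> nlinarith [mul_nonneg hl.le h2, sq_nonneg (Real.log 3), mul_le_mul_of_nonneg_left h1 hl.le]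

/-- odd-indexed terms -/
noncomputable def FF (s : ℝ) (k : ℕ) : ℝ := mulog2 (9 * (2 * k + 1) ^ 2) / ((2 * k + 1 : ℕ) : ℝ) ^ s

lemma summable_FF {s : ℝ} (hs : 1 < s) : Summable (FF s) := by
  have h1 : Summable fun n : ℕ => (n : ℝ) ^ (-((1 + s) / 2)) := by
    rw [Real.summable_nat_rpow]; linarith
  have h2 : Summable fun n : ℕ => (n : ℝ) ^ (-s) := by
    rw [Real.summable_nat_rpow]; linarith
  have hinj : Function.Injective (fun k : ℕ => 2 * k + 1) := fun a b h => by simpa using h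
  have h3 := ((h1.mul_left (2 * Real.log 3 / ((s - 1) / 2))).add (h2.mul_left (Real.log 3 ^ 2))).comp_injective hinj
  refine Summable.of_norm_bounded h3 fun k => ?_
  simp only [Function.comp, FF]
  set m := 2 * k + 1 with hm
  have hm0 : (0 : ℝ) < m := by rw [hm]; positivity
  have hl : 0 < Real.log 3 := Real.log_pos (by norm_num)
  have e1 := mulog2_bound m (by omega)
  have e2 := Real.log_le_rpow_div (x := m) (ε := (s - 1) / 2) hm0.le (by linarith)
  have e3 : (m : ℝ) ^ (-((1 + s) / 2)) = m ^ ((s - 1) / 2) * m ^ (-s) := by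
    rw [← Real.rpow_add hm0]; congr 1; ring
  rw [div_eq_mul_inv, ← Real.rpow_neg hm0.le, norm_mul, Real.norm_eq_abs, Real.norm_eq_abs, abs_of_pos (Real.rpow_pos_of_pos hm0 (-s)), e3]
  calc _ ≤ (2 * Real.log 3 * (m ^ ((s - 1) / 2) / ((s - 1) / 2)) + Real.log 3 ^ 2) * (m : ℝ) ^ (-s) := by
        apply mul_le_mul_of_nonneg_right _ (Real.rpow_pos_of_pos hm0 _).le
        exact e1.trans (by gcongr)
    _ = _ := by ring

noncomputable def RR (a : ZMod 6) (s : ℝ) : ℝ := ∑' n, residueClass a n / (n : ℝ) ^ s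

lemma summable_RR (a : ZMod 6) {s : ℝ} (hs : 1 < s) :
    Summable fun n : ℕ => residueClass a n / (n : ℝ) ^ s :=
  LSeries.summable_real_of_abscissaOfAbsConv_lt <|
        (abscissaOfAbsConv_residueClass_le_one a).trans_lt <| mod_cast hs

lemma RR_eq {a : ZMod 6} (ha : IsUnit a) {x : ℝ} (hx : 1 < x) :
    RR a x = (LFunctionResidueClassAux a x).re + ((Nat.totient 6 : ℕ) : ℝ)⁻¹ / (x - 1) := by
  refine Complex.ofReal_injective ?_
  simp only [RR, Complex.ofReal_tsum, Complex.ofReal_div, Complex.ofReal_cpow (Nat.cast_nonneg _), Complex.ofReal_natCast,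
      Complex.ofReal_add, Complex.ofReal_inv, Complex.ofReal_sub, Complex.ofReal_one]
  simp_rw [← LFunctionResidueClassAux_real ha hx,
      eqOn_LFunctionResidueClassAux ha <| Set.mem_ofPred.mpr (Complex.ofReal_re x ▸ hx), sub_add_cancel,
      LSeries, LSeries.term]
  refine tsum_congr fun n ↦ ?_
  split_ifs with hn
  · simp only [hn, residueClass_apply_zero, Complex.ofReal_zero, zero_div]
  · rfl

lemma tendsto_RR {a : ZMod 6} (ha : IsUnit a) :
    Tendsto (fun s : ℝ => (s - 1) * RR a s) (𝓝[>] 1) (𝓝 (1 / 2)) := by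
  have hc : ContinuousOn (fun x : ℝ ↦ (LFunctionResidueClassAux a x).re) (Set.Ici 1) :=
    Complex.continuous_re.continuousOn.comp (t := Set.univ) (continuousOn_LFunctionResidueClassAux a)
      (fun ⦃x⦄ a ↦ trivial) |>.comp Complex.continuous_ofReal.continuousOn fun x hx ↦ by
        simpa only [Set.mem_ofPred_eq, Complex.ofReal_re, Set.mem_Ici] using hx
  have h1 : Tendsto (fun x : ℝ ↦ (LFunctionResidueClassAux a x).re) (𝓝[>] 1) (𝓝 (LFunctionResidueClassAux a (1 : ℝ)).re) :=
    (hc 1 (by simp)).mono_left (nhdsWithin_mono _ Set.Ioi_subset_Ici_self)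
  have h2 : Tendsto (fun s : ℝ => s - 1) (𝓝[>] 1) (𝓝 0) := by
    have : Tendsto (fun s : ℝ => s - 1) (𝓝 1) (𝓝 (1 - 1)) := (continuous_id.sub continuous_const).tendsto 1
    rw [sub_self] at this
    exact this.mono_left nhdsWithin_le_nhds
  have h3 := (h2.mul h1).add (tendsto_const_nhds (x := (1 / 2 : ℝ)))
  rw [zero_mul, zero_add] at h3
  refine h3.congr' ?_
  filter_upwards [self_mem_nhdsWithin] with s hs
  have hs' : s - 1 ≠ 0 := sub_ne_zero.2 (ne_of_gt hs)
  rw [RR_eq ha hs]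
  generalize (LFunctionResidueClassAux a s).re = z
  rw [show Nat.totient 6 = 2 by decide]
  push_cast
  field_simp

lemma tsum_odd {a : ZMod 6} (ha : a = 1 ∨ a = 5) (s : ℝ) :
    ∑' k : ℕ, residueClass a (2 * k + 1) / ((2 * k + 1 : ℕ) : ℝ) ^ s = RR a s := by
  have hinj : Function.Injective (fun k : ℕ => 2 * k + 1) := fun a b h => by simpa using h
  refine hinj.tsum_eq (f := fun n : ℕ => residueClass a n / (n : ℝ) ^ s) ?_
  intro n hn
  have : (n : ZMod 6) = a := by
    by_contra hne
    apply hn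
    simp [residueClass, hne]
  have hodd : n % 2 = 1 := by
    rcases ha with rfl | rfl
    · have : ((n : ℕ) : ZMod 6) = ((1 : ℕ) : ZMod 6) := by simpa using this
      rw [ZMod.natCast_eq_natCast_iff'] at this; omega
    · have : ((n : ℕ) : ZMod 6) = ((5 : ℕ) : ZMod 6) := by simpa using this
      rw [ZMod.natCast_eq_natCast_iff'] at this; omega
  exact ⟨n / 2, by simp only; omega⟩

lemma res_sum (k : ℕ) : residueClass (1 : ZMod 6) (2 * k + 1) + residueClass (5 : ZMod 6) (2 * k + 1) =
    if k % 3 = 1 then 0 else vonMangoldt (2 * k + 1) := by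
  have h1 : (((2 * k + 1 : ℕ) : ZMod 6) = 1) ↔ k % 3 = 0 := by
    have := ZMod.natCast_eq_natCast_iff' (2 * k + 1) 1 6
    rw [Nat.cast_one] at this
    rw [this]; omega
  have h5 : (((2 * k + 1 : ℕ) : ZMod 6) = 5) ↔ k % 3 = 2 := by
    have := ZMod.natCast_eq_natCast_iff' (2 * k + 1) 5 6
    rw [Nat.cast_ofNat] at this
    rw [this]; omega
  simp only [residueClass, Set.indicator_apply, Set.mem_ofPred_eq, h1, h5]
  have : k % 3 < 3 := Nat.mod_lt _ (by norm_num)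
  interval_cases k % 3 <;> simp

lemma FF_split (s : ℝ) (k : ℕ) : FF s k =
    2 * Real.log 3 * (residueClass (1 : ZMod 6) (2 * k + 1) / ((2 * k + 1 : ℕ) : ℝ) ^ s
      + residueClass (5 : ZMod 6) (2 * k + 1) / ((2 * k + 1 : ℕ) : ℝ) ^ s)
    - (if k = 0 then Real.log 3 ^ 2 else 0)
    + (if k % 3 = 1 then (3 : ℝ) ^ (-s) * FF s (k / 3) else 0) := by
  rw [← add_div, res_sum]
  by_cases h : k % 3 = 1
  · obtain ⟨j, rfl⟩ : ∃ j, k = 3 * j + 1 := ⟨k / 3, by omega⟩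
    have e : (3 * j + 1) / 3 = j := by omega
    rw [if_pos h, if_pos h, e, if_neg (by omega), FF, FF,
      show 2 * (3 * j + 1) + 1 = 3 * (2 * j + 1) by ring, mulog2_three_mul (by omega),
      Nat.cast_mul, Real.mul_rpow (by positivity) (by positivity), Real.rpow_neg (by norm_num)]
    push_cast
    have : (0 : ℝ) < (2 * (j : ℝ) + 1) ^ s := by positivity
    field_simp
    ring
  · rw [if_neg h, if_neg h, FF, mulog2_coprime]
    · by_cases h0 : k = 0
      · subst h0; simp
      · simp [h0]; ring
    · rw [Nat.Prime.coprime_iff_not_dvd Nat.prime_three]; omega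

lemma tsum_FF {s : ℝ} (hs : 1 < s) :
    (1 - (3 : ℝ) ^ (-s)) * ∑' k, FF s k = 2 * Real.log 3 * (RR 1 s + RR 5 s) - Real.log 3 ^ 2 := by
  have hinj : Function.Injective (fun k : ℕ => 2 * k + 1) := fun a b h => by simpa using h
  have hinj3 : Function.Injective (fun k : ℕ => 3 * k + 1) := fun a b h => by simpa using h
  have s1 := (summable_RR 1 hs).comp_injective hinj
  have s5 := (summable_RR 5 hs).comp_injective hinj
  have t1 := tsum_odd (Or.inl rfl : (1 : ZMod 6) = 1 ∨ _) s
  have t5 := tsum_odd (Or.inr rfl : (5 : ZMod 6) = 1 ∨ _) s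
  have H1 := s1.hasSum
  have H5 := s5.hasSum
  simp only [Function.comp_def] at H1 H5
  rw [t1] at H1
  rw [t5] at H5
  have H0 := hasSum_ite_eq (0 : ℕ) (Real.log 3 ^ 2)
  have H3 : HasSum (fun k : ℕ => if k % 3 = 1 then (3 : ℝ) ^ (-s) * FF s (k / 3) else 0) ((3 : ℝ) ^ (-s) * ∑' k, FF s k) := by
    rw [← hinj3.hasSum_iff]
    · have hc : ((fun k : ℕ => if k % 3 = 1 then (3 : ℝ) ^ (-s) * FF s (k / 3) else 0) ∘
          fun k : ℕ => 3 * k + 1) = fun j => (3 : ℝ) ^ (-s) * FF s j := by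
        funext j
        have e1 : (3 * j + 1) / 3 = j := by omega
        have e2 : (3 * j + 1) % 3 = 1 := by omega
        simp only [Function.comp, e1, e2, if_true]
      rw [hc]
      exact (summable_FF hs).hasSum.mul_left ((3 : ℝ) ^ (-s))
    · intro k hk
      rw [if_neg]
      intro h
      exact hk ⟨k / 3, by simp only; omega⟩
  have H := (((H1.add H5).mul_left (2 * Real.log 3)).sub H0).add H3
  have hF : FF s = _ := funext (FF_split s)
  rw [← hF] at H
  have := H.tsum_eq
  linarith

theorem A_residue_even (D : ℕ) (hD : 0 < D) (heven : 2 ∣ D) (hmod : D % 6 ≠ 4) :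
    Filter.Tendsto (fun u : ℝ => (u - 1 / 2) * (3 : ℝ) ^ (-2 * u) *
        ∑' n : ℕ, mulog2 (9 * (2 * (n + D / 6 + 1) - 1) ^ 2) *
          ((2 * (n + D / 6 + 1) - 1 : ℕ) : ℝ) ^ (-2 * u))
      (nhdsWithin (1 / 2) (Set.Ioi (1 / 2))) (nhds (Real.log 3 / 2)) := by
  have hu : Tendsto (fun u : ℝ => 2 * u) (𝓝[>] (1 / 2)) (𝓝[>] 1) := by
    apply tendsto_nhdsWithin_of_tendsto_nhds_of_eventually_within
    · have : Tendsto (fun u : ℝ => 2 * u) (𝓝 (1 / 2)) (𝓝 (2 * (1 / 2))) :=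
        (continuous_const.mul continuous_id).tendsto _
      norm_num at this ⊢
      exact this.mono_left nhdsWithin_le_nhds
    · filter_upwards [self_mem_nhdsWithin] with u hu
      have : (1 / 2 : ℝ) < u := hu
      show (1 : ℝ) < 2 * u
      linarith
  have key : Tendsto (fun s : ℝ => (s - 1) / 2 * (3 : ℝ) ^ (-s) *
      ((2 * Real.log 3 * (RR 1 s + RR 5 s) - Real.log 3 ^ 2) / (1 - (3 : ℝ) ^ (-s))
        - ∑ k ∈ Finset.range (D / 6), FF s k)) (𝓝[>] 1) (𝓝 (Real.log 3 / 2)) := by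
    have p3 : Tendsto (fun s : ℝ => (3 : ℝ) ^ (-s)) (𝓝[>] 1) (𝓝 (1 / 3)) := by
      have : Continuous (fun s : ℝ => (3 : ℝ) ^ (-s)) :=
        Real.continuous_const_rpow (by norm_num) |>.comp continuous_neg
      have := this.tendsto 1
      rw [Real.rpow_neg_one] at this
      rw [one_div]
      exact this.mono_left nhdsWithin_le_nhds
    have z : Tendsto (fun s : ℝ => s - 1) (𝓝[>] 1) (𝓝 0) := by
      have : Tendsto (fun s : ℝ => s - 1) (𝓝 1) (𝓝 (1 - 1)) := (continuous_id.sub continuous_const).tendsto 1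
      rw [sub_self] at this
      exact this.mono_left nhdsWithin_le_nhds
    have r1 := tendsto_RR (a := 1) isUnit_one
    have r5 := tendsto_RR (a := 5) (by decide)
    have f : Tendsto (fun s : ℝ => ∑ k ∈ Finset.range (D / 6), FF s k) (𝓝[>] 1)
        (𝓝 (∑ k ∈ Finset.range (D / 6), FF 1 k)) := by
      apply tendsto_finsetSum
      intro k _
      have hp : (0 : ℝ) < ((2 * k + 1 : ℕ) : ℝ) := by positivity
      have : Continuous (fun s : ℝ => FF s k) := by
        unfold FF
        exact continuous_const.div (Real.continuous_const_rpow hp.ne') (fun s => (Real.rpow_pos_of_pos hp s).ne')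
      exact (this.tendsto 1).mono_left nhdsWithin_le_nhds
    have T := ((p3.div_const 2).mul (((((r1.add r5).const_mul (2 * Real.log 3)).sub (z.mul_const (Real.log 3 ^ 2))).div
      (tendsto_const_nhds (x := (1 : ℝ)) |>.sub p3) (by norm_num)).sub (z.mul f)))
    have e : 1 / 3 / 2 * ((2 * Real.log 3 * (1 / 2 + 1 / 2) - 0 * Real.log 3 ^ 2) / (1 - 1 / 3) - 0 * ∑ k ∈ Finset.range (D / 6), FF 1 k) = Real.log 3 / 2 := by ring
    rw [e] at T
    refine T.congr fun s => ?_
    simp only [Pi.div_apply]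
    ring
  refine (key.comp hu).congr' ?_
  filter_upwards [self_mem_nhdsWithin] with u hu'
  have hs : 1 < 2 * u := by
    have : (1 / 2 : ℝ) < u := hu'
    linarith
  simp only [Function.comp]
  have h3 : (3 : ℝ) ^ (-(2 * u)) < 1 := Real.rpow_lt_one_of_one_lt_of_neg (by norm_num) (by linarith)
  have hne : 1 - (3 : ℝ) ^ (-(2 * u)) ≠ 0 := by linarith
  have hT := tsum_FF hs
  have hsplit := (summable_FF hs).sum_add_tsum_nat_add (D / 6)
  have e : (2 * Real.log 3 * (RR 1 (2 * u) + RR 5 (2 * u)) - Real.log 3 ^ 2) / (1 - (3 : ℝ) ^ (-(2 * u)))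
      = ∑' k, FF (2 * u) k := by
    rw [← hT]; field_simp
  rw [e, ← hsplit, add_sub_cancel_left, show -2 * u = -(2 * u) by ring, show (2 * u - 1) / 2 = u - 1 / 2 by ring]
  congr 1
  apply tsum_congr
  intro n
  rw [show 2 * (n + D / 6 + 1) - 1 = 2 * (n + D / 6) + 1 by omega, FF, div_eq_mul_inv, ← Real.rpow_neg (by positivity)]
end
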